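/- Let n ≥ 1 and let 0 < p, q < ∞ with n(1/p − 1/q) < 1. Then for every holomorphic polynomial P on ℂⁿ, the operator J_P is compact from H^p to H^q; that is, ‖J_P f_k‖_{H^q} → 0 for every sequence (f_k) of functions in H^p with sup_k ‖f_k‖_{H^p} < ∞ that converges to 0 uniformly on compact subsets of B_n. -/

import Mathlib

open MeasureTheory Metric Set Filter
open scoped ENNReal NNReal Topology

noncomputable section

/-- ℂⁿ with its Euclidean (Hermitian) structure. -/
abbrev En (n : ℕ) := EuclideanSpace ℂ (Fin n)

instance (n : ℕ) : MeasurableSpace (En n) := borel _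
instance (n : ℕ) : BorelSpace (En n) := ⟨rfl⟩

/-- The open unit ball `B_n` of ℂⁿ. -/
def Bn (n : ℕ) : Set (En n) := Metric.ball 0 1

/-- The unit sphere `S_n = ∂B_n`. -/
def Sn (n : ℕ) : Set (En n) := Metric.sphere 0 1

/-- The Hermitian inner product `⟨z,w⟩ = ∑ z_k * conj (w_k)`. -/
def herm {n : ℕ} (z w : En n) : ℂ := ∑ k, z k * (starRingEnd ℂ) (w k)

/-- The surface measure on the unit sphere, normalized so that `σ(S_n) = 1`
(the `(2n-1)`-dimensional Hausdorff measure restricted to the sphere, normalized). -/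
def sigmaS (n : ℕ) : Measure (En n) :=
  ((μH[(2 * n - 1 : ℝ)] (Sn n))⁻¹) • (μH[(2 * n - 1 : ℝ)]).restrict (Sn n)

/-- Lebesgue measure on the unit ball, normalized so that `v(B_n) = 1`. -/
def volN (n : ℕ) : Measure (En n) :=
  ((volume (Bn n))⁻¹) • volume.restrict (Bn n)

/-- The radial derivative `Rg(z) = ∑ z_k ∂g/∂z_k (z) = (Dg)(z)[z]`. -/
def radD {n : ℕ} (g : En n → ℂ) (z : En n) : ℂ := fderiv ℂ g z z

/-- The Volterra-type integration operator `J_g f(z) = ∫₀¹ f(tz) Rg(tz) dt/t`. -/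
def J {n : ℕ} (g f : En n → ℂ) (z : En n) : ℂ :=
  ∫ t in Set.Ioo (0 : ℝ) 1, f (t • z) * radD g (t • z) / (t : ℂ)

/-- The Hardy space quasinorm `‖f‖_{H^p}`, with values in `ℝ≥0∞`:
`‖f‖_{H^p}^p = sup_{0<r<1} ∫_{S_n} |f(rζ)|^p dσ(ζ)`. -/
def hNorm (n : ℕ) (p : ℝ) (f : En n → ℂ) : ℝ≥0∞ :=
  (⨆ r ∈ Set.Ioo (0 : ℝ) 1,
    ∫⁻ ζ, (‖f (r • ζ)‖₊ : ℝ≥0∞) ^ p ∂(sigmaS n)) ^ (1 / p)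

/-- Membership in the Hardy space `H^p(B_n)`. -/
def MemHp (n : ℕ) (p : ℝ) (f : En n → ℂ) : Prop :=
  DifferentiableOn ℂ f (Bn n) ∧ hNorm n p f < ⊤

/-- The Carleson box `B_δ(ζ) = {z ∈ B_n : |1 - ⟨z,ζ⟩| < δ}`. -/
def cBox {n : ℕ} (ζ : En n) (δ : ℝ) : Set (En n) :=
  {z ∈ Bn n | ‖(1 : ℂ) - herm z ζ‖ < δ}

/-- The measure `dμ_g(z) = |Rg(z)|²(1-|z|²) dv(z)`. -/
def muJ (n : ℕ) (g : En n → ℂ) : Measure (En n) :=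
  (volN n).withDensity
    (fun z => (‖radD g z‖₊ : ℝ≥0∞) ^ 2 * ENNReal.ofReal (1 - ‖z‖ ^ 2))

/-- The admissible approach region `Γ_α(ζ) = {z ∈ B_n : |1-⟨z,ζ⟩| < (α/2)(1-|z|²)}`. -/
def Gam {n : ℕ} (α : ℝ) (ζ : En n) : Set (En n) :=
  {z ∈ Bn n | ‖(1 : ℂ) - herm z ζ‖ < α / 2 * (1 - ‖z‖ ^ 2)}

open Classical in
/-- The involutive automorphism `φ_a` of the unit ball interchanging `0` and `a`:
`φ_a(z) = (a - P_a z - √(1-|a|²) (z - P_a z)) / (1 - ⟨z,a⟩)`, where `P_a` is the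
orthogonal projection onto `ℂa`. -/
def mob {n : ℕ} (a z : En n) : En n :=
  if a = 0 then -z
  else ((1 : ℂ) - herm z a)⁻¹ •
    ((a - (herm z a / herm a a) • a) -
      ((Real.sqrt (1 - ‖a‖ ^ 2) : ℂ)) • (z - (herm z a / herm a a) • a))

/-- The norm of the invariant (real) gradient `∇̃f(z) = ∇(f ∘ φ_z)(0)`. -/
def invGrad {n : ℕ} {F : Type*} [NormedAddCommGroup F] [NormedSpace ℝ F]
    (f : En n → F) (z : En n) : ℝ :=
  ‖fderiv ℝ (fun w => f (mob z w)) 0‖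

/-- The invariant measure `dλ_n(z) = (1-|z|²)^{-(n+1)} dv(z)`. -/
def lamN (n : ℕ) : Measure (En n) :=
  (volN n).withDensity (fun z => ENNReal.ofReal ((1 - ‖z‖ ^ 2) ^ (-(n + 1 : ℝ))))

/-- The invariant Poisson integral `u_φ(z) = ∫_{S_n} φ(ζ) (1-|z|²)ⁿ/|1-⟨z,ζ⟩|^{2n} dσ(ζ)`. -/
def poisson (n : ℕ) (φ : En n → ℝ) (z : En n) : ℝ :=
  ∫ ζ, φ ζ * ((1 - ‖z‖ ^ 2) ^ n / ‖(1 : ℂ) - herm z ζ‖ ^ (2 * n)) ∂(sigmaS n)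

/-- The function `μ̃(ζ) = ∫_{Γ_α(ζ)} (1-|z|²)^{-n} dμ(z)`. -/
def tildeMu (n : ℕ) (α : ℝ) (μ : Measure (En n)) (ζ : En n) : ℝ≥0∞ :=
  ∫⁻ z in Gam α ζ, ENNReal.ofReal ((1 - ‖z‖ ^ 2) ^ (-(n : ℝ))) ∂μ

/-- The `L^{p/(p-s)}(S_n)`-norm of `μ̃`. -/
def tildeMuNorm (n : ℕ) (α p s : ℝ) (μ : Measure (En n)) : ℝ≥0∞ :=
  (∫⁻ ζ, tildeMu n α μ ζ ^ (p / (p - s)) ∂(sigmaS n)) ^ ((p - s) / p)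

lemma isProbabilityMeasure_sigmaS {n : ℕ} (h : sigmaS n ≠ 0) :
    IsProbabilityMeasure (sigmaS n) := by
  have h0 : μH[(2 * n - 1 : ℝ)] (Sn n) ≠ 0 := fun h0 =>
    h (by simp [sigmaS, Measure.restrict_eq_zero.2 h0])
  have ht : μH[(2 * n - 1 : ℝ)] (Sn n) ≠ ⊤ := fun h0 => h (by simp [sigmaS, h0])
  exact ⟨by simp [sigmaS, ENNReal.inv_mul_cancel h0 ht]⟩

lemma measurePreserving_sigmaS {n : ℕ} (T : En n ≃ₗᵢ[ℂ] En n) :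
    MeasurePreserving T (sigmaS n) (sigmaS n) := by
  have h1 := T.toIsometryEquiv.measurePreserving_hausdorffMeasure (2 * n - 1 : ℝ)
  have hS : MeasurableSet (Sn n) := isClosed_sphere.measurableSet
  have h2 := h1.restrict_preimage hS
  have h3 : T.toIsometryEquiv ⁻¹' (Sn n) = Sn n := by
    ext z
    simp [Sn]
  rw [h3] at h2
  exact h2.smul_measure _

lemma ae_sigmaS_norm {n : ℕ} : ∀ᵐ ζ ∂(sigmaS n), ‖ζ‖ = 1 := by
  have h : ∀ᵐ ζ ∂((μH[(2 * n - 1 : ℝ)] : Measure (En n)).restrict (Sn n)), ‖ζ‖ = 1 := by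
    filter_upwards [ae_restrict_mem (isClosed_sphere.measurableSet)] with ζ hζ
    simpa [Sn] using hζ
  exact Measure.ae_smul_measure h _

lemma exists_linearIsometryEquiv_apply_eq {n : ℕ} {e e' : En (n + 1)} (he : ‖e‖ = 1)
    (he' : ‖e'‖ = 1) : ∃ T : En (n + 1) ≃ₗᵢ[ℂ] En (n + 1), T e = e' := by
  have key : ∀ u : En (n + 1), ‖u‖ = 1 →
      ∃ b : OrthonormalBasis (Fin (n + 1)) ℂ (En (n + 1)), b 0 = u := by
    intro u hu
    have hv : Orthonormal ℂ (({0} : Set (Fin (n + 1))).domRestrict (fun _ => u)) := by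
      constructor
      · intro i
        simpa using hu
      · intro i j hij
        exact absurd (Subsingleton.elim i j) hij
    obtain ⟨b, hb⟩ := hv.exists_orthonormalBasis_extension_of_card_eq (by simp)
    exact ⟨b, hb 0 rfl⟩
  obtain ⟨b, hb⟩ := key e he
  obtain ⟨b', hb'⟩ := key e' he'
  refine ⟨b.equiv b' (Equiv.refl _), ?_⟩
  rw [← hb, OrthonormalBasis.equiv_apply_basis]
  simpa using hb'

lemma sigmaS_cap_eq {n : ℕ} (δ : ℝ) {e e' : En (n + 1)} (he : ‖e‖ = 1) (he' : ‖e'‖ = 1) :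
    sigmaS (n + 1) {ζ | 1 - δ < ‖inner ℂ e ζ‖} = sigmaS (n + 1) {ζ | 1 - δ < ‖inner ℂ e' ζ‖} := by
  obtain ⟨T, hT⟩ := exists_linearIsometryEquiv_apply_eq he he'
  have hm : MeasurableSet {ζ : En (n + 1) | 1 - δ < ‖inner ℂ e' ζ‖} :=
    (isOpen_lt continuous_const (by fun_prop)).measurableSet
  rw [← (measurePreserving_sigmaS T).measure_preimage hm.nullMeasurableSet]
  congr 1
  ext ζ
  simp only [mem_ofPred_eq, mem_preimage, ← hT, LinearIsometryEquiv.inner_map_map]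

lemma one_sub_le_norm_inner {n : ℕ} {x y : En n} {a b : ℂ} (hx : ‖x‖ = 1) (hy : ‖y‖ = 1)
    (ha : 1 ≤ ‖a‖) (hb : 1 ≤ ‖b‖) :
    1 - ‖a • x - b • y‖ ^ 2 / 2 ≤ ‖inner ℂ x y‖ := by
  have h1 := norm_sub_sq (𝕜 := ℂ) (a • x) (b • y)
  rw [inner_smul_left, inner_smul_right, norm_smul, norm_smul, hx, hy] at h1
  have h2 : RCLike.re ((starRingEnd ℂ) a * (b * inner ℂ x y)) ≤ ‖a‖ * (‖b‖ * ‖inner ℂ x y‖) := by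
    refine (RCLike.re_le_norm _).trans ?_
    simp
  have h3 : ‖inner ℂ x y‖ ≤ 1 := by
    have := norm_inner_le_norm (𝕜 := ℂ) x y
    rwa [hx, hy, one_mul] at this
  have h4 : 1 ≤ ‖a‖ * ‖b‖ := one_le_mul_of_one_le_of_one_le ha hb
  nlinarith [sq_nonneg (‖a‖ - ‖b‖), mul_nonneg (sub_nonneg.2 h4) (sub_nonneg.2 h3)]

open Classical in
lemma sigmaS_cap_ge_aux {m : ℕ} (h : sigmaS (m + 1) ≠ 0) (L : ℕ) (hL : 0 < L) (δ : ℝ)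
    (hδ : (m + 1 : ℝ) < δ * L ^ 2) (e : En (m + 1)) (he : ‖e‖ = 1) :
    1 ≤ ((m + 1) * ((2 * L + 1) ^ 2) ^ m : ℕ) * sigmaS (m + 1) {ζ | 1 - δ < ‖inner ℂ e ζ‖} := by
  have hprob := isProbabilityMeasure_sigmaS h
  have hLR : (0 : ℝ) < L := by exact_mod_cast hL
  have hmax : ∀ ζ : En (m + 1), ∃ k, ∀ i, ‖ζ i‖ ≤ ‖ζ k‖ := fun ζ =>
    Finite.exists_max (fun i => ‖ζ i‖)
  choose κ hκ using hmax
  let box : Finset (ℤ × ℤ) := Finset.Icc (-L : ℤ) L ×ˢ Finset.Icc (-L : ℤ) L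
  let F : Finset (Σ _ : Fin (m + 1), (Fin (m + 1) → ℤ × ℤ)) :=
    Finset.univ.sigma (fun k => Fintype.piFinset (fun i => if i = k then {((L : ℤ), 0)} else box))
  let code : En (m + 1) → (Σ _ : Fin (m + 1), (Fin (m + 1) → ℤ × ℤ)) := fun ζ =>
    ⟨κ ζ, fun i => (⌊L * (ζ i / ζ (κ ζ)).re⌋, ⌊L * (ζ i / ζ (κ ζ)).im⌋)⟩
  have hne : ∀ ζ : En (m + 1), ‖ζ‖ = 1 → ζ (κ ζ) ≠ 0 := by
    intro ζ hζ h0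
    have : ζ = 0 := by
      ext i
      have := hκ ζ i
      rw [h0, norm_zero] at this
      simpa using this
    simp [this] at hζ
  have hcard : F.card = (m + 1) * ((2 * L + 1) ^ 2) ^ m := by
    have hb : box.card = (2 * L + 1) ^ 2 := by
      simp only [box, Finset.card_product, Int.card_Icc, sq]
      congr 1 <;> omega
    simp only [F, Finset.card_sigma, Fintype.card_piFinset]
    rw [Finset.sum_congr rfl (g := fun _ => ((2 * L + 1) ^ 2) ^ m)]
    · simp
    · intro k _
      rw [Fintype.prod_eq_mul_prod_compl k, Finset.prod_congr rfl (g := fun _ => (2 * L + 1) ^ 2)]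
      · simp [Finset.card_compl]
      · intro i hi
        have : i ≠ k := by simpa using hi
        rw [if_neg this, hb]
  have hcode : ∀ ζ : En (m + 1), ‖ζ‖ = 1 → code ζ ∈ F := by
    intro ζ hζ
    simp only [F, Finset.mem_sigma, Finset.mem_univ, true_and, Fintype.mem_piFinset, code]
    intro i
    split_ifs with hi
    · rw [hi, div_self (hne ζ hζ)]
      simp
    · have hu : ‖ζ i / ζ (κ ζ)‖ ≤ 1 := by
        rw [norm_div]
        exact div_le_one_of_le₀ (hκ ζ i) (norm_nonneg _)
      have aux : ∀ x : ℝ, |x| ≤ 1 → ⌊L * x⌋ ∈ Finset.Icc (-L : ℤ) L := by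
        intro x hx
        rw [abs_le] at hx
        rw [Finset.mem_Icc]
        constructor
        · rw [Int.le_floor]
          push_cast
          nlinarith
        · rw [← Int.cast_le (R := ℝ)]
          refine (Int.floor_le _).trans ?_
          push_cast
          nlinarith
      exact Finset.mem_product.2
        ⟨aux _ ((Complex.abs_re_le_norm _).trans hu), aux _ ((Complex.abs_im_le_norm _).trans hu)⟩
  have hclose : ∀ x y : En (m + 1), ‖x‖ = 1 → ‖y‖ = 1 → code x = code y →
      1 - δ < ‖inner ℂ x y‖ := by
    intro x y hx hy hxy
    have hge : ∀ ζ : En (m + 1), ‖ζ‖ = 1 → 1 ≤ ‖(ζ (κ ζ))⁻¹‖ := by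
      intro ζ hζ
      rw [norm_inv]
      refine (one_le_inv₀ (norm_pos_iff.2 (hne ζ hζ))).2 ?_
      rw [← hζ]
      exact PiLp.norm_apply_le ζ _
    refine lt_of_lt_of_le ?_ (one_sub_le_norm_inner hx hy (hge x hx) (hge y hy))
    have hi : ∀ i, ‖((x (κ x))⁻¹ • x - (y (κ y))⁻¹ • y) i‖ ^ 2 ≤ 2 / L ^ 2 := by
      intro i
      have h2 : (code x).2 i = (code y).2 i := by rw [hxy]
      simp only [code, Prod.mk.injEq] at h2
      have h3 := Int.abs_sub_lt_one_of_floor_eq_floor h2.1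
      have h4 := Int.abs_sub_lt_one_of_floor_eq_floor h2.2
      rw [PiLp.sub_apply, PiLp.smul_apply, PiLp.smul_apply, smul_eq_mul, smul_eq_mul,
        inv_mul_eq_div, inv_mul_eq_div, Complex.sq_norm, Complex.normSq_apply, Complex.sub_re,
        Complex.sub_im, le_div_iff₀ (by positivity)]
      rw [← mul_sub, abs_lt] at h3 h4
      nlinarith
    have hs : ‖(x (κ x))⁻¹ • x - (y (κ y))⁻¹ • y‖ ^ 2 ≤ (m + 1) * (2 / L ^ 2) := by
      rw [EuclideanSpace.norm_sq_eq]
      refine (Finset.sum_le_sum (fun i _ => hi i)).trans ?_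
      simp
    have : (m + 1 : ℝ) / L ^ 2 < δ := by rwa [div_lt_iff₀ (by positivity)]
    have h5 : (m + 1 : ℝ) * (2 / L ^ 2) = 2 * ((m + 1) / L ^ 2) := by ring
    linarith
  set M := sigmaS (m + 1) {ζ | 1 - δ < ‖inner ℂ e ζ‖} with hM
  have hcell : ∀ c ∈ F, sigmaS (m + 1) {ζ | ‖ζ‖ = 1 ∧ code ζ = c} ≤ M := by
    intro c _
    by_cases hc : ∃ η : En (m + 1), ‖η‖ = 1 ∧ code η = c
    · obtain ⟨η, hη, rfl⟩ := hc
      rw [hM, sigmaS_cap_eq δ he hη]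
      exact measure_mono fun ζ hζ => hclose η ζ hη hζ.1 hζ.2.symm
    · have : {ζ : En (m + 1) | ‖ζ‖ = 1 ∧ code ζ = c} = ∅ := by
        ext ζ
        simpa using fun h1 h2 => hc ⟨ζ, h1, h2⟩
      simp [this]
  calc (1 : ℝ≥0∞) = sigmaS (m + 1) univ := (measure_univ).symm
    _ ≤ sigmaS (m + 1) (⋃ c ∈ F, {ζ | ‖ζ‖ = 1 ∧ code ζ = c}) := by
      refine measure_mono_ae ?_
      filter_upwards [ae_sigmaS_norm] with ζ hζ _
      exact mem_biUnion (hcode ζ hζ) ⟨hζ, rfl⟩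
    _ ≤ ∑ c ∈ F, sigmaS (m + 1) {ζ | ‖ζ‖ = 1 ∧ code ζ = c} := measure_biUnion_finset_le _ _
    _ ≤ ∑ c ∈ F, M := Finset.sum_le_sum hcell
    _ = _ := by rw [Finset.sum_const, hcard, nsmul_eq_mul]

lemma exists_le_sigmaS_cap {m : ℕ} (h : sigmaS (m + 1) ≠ 0) :
    ∃ c : ℝ, 0 < c ∧ ∀ δ ∈ Ioc (0 : ℝ) 1, ∀ e : En (m + 1), ‖e‖ = 1 →
      ENNReal.ofReal (c * δ ^ m) ≤ sigmaS (m + 1) {ζ | 1 - δ < ‖inner ℂ e ζ‖} := by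
  refine ⟨((m + 1) * (36 * (m + 1)) ^ m)⁻¹, by positivity, fun δ hδ e he => ?_⟩
  have hm1 : (1 : ℝ) ≤ (m + 1) / δ := by
    rw [le_div_iff₀ hδ.1]
    have : (0 : ℝ) ≤ m := by positivity
    linarith [hδ.2]
  set s := Real.sqrt ((m + 1) / δ) with hs
  have hs2 : s ^ 2 = (m + 1) / δ := Real.sq_sqrt (by linarith)
  have hs1 : 1 ≤ s := Real.one_le_sqrt.2 hm1
  set L := ⌊s⌋₊ + 1 with hLdef
  have hL1 : s < L := by
    rw [hLdef]
    exact_mod_cast Nat.lt_floor_add_one s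
  have hL2 : (L : ℝ) ≤ 2 * s := by
    have := Nat.floor_le (show 0 ≤ s by linarith)
    rw [hLdef]
    push_cast
    linarith
  have hkey := sigmaS_cap_ge_aux h L (Nat.succ_pos _) δ (by
    have : s ^ 2 < (L : ℝ) ^ 2 := by nlinarith
    rw [hs2, div_lt_iff₀ hδ.1] at this
    linarith) e he
  set M := sigmaS (m + 1) {ζ | 1 - δ < ‖inner ℂ e ζ‖} with hM
  have hN : (((m + 1) * ((2 * L + 1) ^ 2) ^ m : ℕ) : ℝ) ≤
      ((m + 1) * (36 * (m + 1)) ^ m) / δ ^ m := by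
    push_cast
    rw [mul_div_assoc, ← div_pow]
    gcongr
    have : (36 * (m + 1) : ℝ) / δ = 36 * s ^ 2 := by rw [hs2]; ring
    rw [this]
    nlinarith
  have hN' : (((m + 1) * ((2 * L + 1) ^ 2) ^ m : ℕ) : ℝ≥0∞) ≤
      ENNReal.ofReal (((m + 1 : ℝ) * (36 * (m + 1)) ^ m) / δ ^ m) := by
    rw [← ENNReal.ofReal_natCast]
    exact ENNReal.ofReal_le_ofReal hN
  have hδm : 0 < δ ^ m := pow_pos hδ.1 m
  calc ENNReal.ofReal (((m + 1 : ℝ) * (36 * (m + 1)) ^ m)⁻¹ * δ ^ m)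
      = ENNReal.ofReal (((m + 1 : ℝ) * (36 * (m + 1)) ^ m)⁻¹ * δ ^ m) * 1 := (mul_one _).symm
    _ ≤ ENNReal.ofReal (((m + 1 : ℝ) * (36 * (m + 1)) ^ m)⁻¹ * δ ^ m) *
        (ENNReal.ofReal (((m + 1 : ℝ) * (36 * (m + 1)) ^ m) / δ ^ m) * M) := by
      gcongr
      exact hkey.trans (by gcongr)
    _ = M := by
      rw [← mul_assoc, ← ENNReal.ofReal_mul (by positivity)]
      have : (((m + 1 : ℝ) * (36 * (m + 1)) ^ m)⁻¹ * δ ^ m) *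
        (((m + 1 : ℝ) * (36 * (m + 1)) ^ m) / δ ^ m) = (1 : ℝ) := by
        field_simp
      rw [this]
      simp

lemma ofReal_mul_enorm_le_lintegral_circle {g : ℂ → ℂ} (hg : DiffContOnCl ℂ g (ball 0 1)) {w : ℂ}
    (hw : ‖w‖ < 1) :
    ENNReal.ofReal (2 * Real.pi * (1 - ‖w‖)) * ‖g w‖ₑ ≤
      ∫⁻ θ in Ioo (-Real.pi) Real.pi, ‖g (circleMap 0 1 θ)‖ₑ := by
  have h1 := hg.circleIntegral_sub_inv_smul (w := w) (by simpa using hw)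
  have hper : Function.Periodic (fun θ : ℝ => deriv (circleMap 0 1) θ •
      ((circleMap 0 1 θ - w)⁻¹ • g (circleMap 0 1 θ))) (2 * Real.pi) := by
    intro θ
    simp only [deriv_circleMap, periodic_circleMap 0 1 θ]
  have h2 := hper.intervalIntegral_add_eq 0 (-Real.pi)
  rw [zero_add, show -Real.pi + 2 * Real.pi = Real.pi by ring] at h2
  rw [circleIntegral, h2, intervalIntegral.integral_of_le (by linarith [Real.pi_pos])] at h1
  have h3 := enorm_integral_le_lintegral_enorm (μ := volume.restrict (Ioc (-Real.pi) Real.pi))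
    (fun θ : ℝ => deriv (circleMap 0 1) θ •
      ((circleMap 0 1 θ - w)⁻¹ • g (circleMap 0 1 θ)))
  rw [h1, ← restrict_Ioo_eq_restrict_Ioc] at h3
  have hw' : 0 < 1 - ‖w‖ := by linarith
  have h4 : ∀ θ : ℝ, ‖deriv (circleMap 0 1) θ •
      ((circleMap 0 1 θ - w)⁻¹ • g (circleMap 0 1 θ))‖ₑ ≤
        ENNReal.ofReal (1 - ‖w‖)⁻¹ * ‖g (circleMap 0 1 θ)‖ₑ := by
    intro θ
    rw [enorm_smul, enorm_smul, ← mul_assoc]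
    gcongr
    rw [← enorm_mul, ← ofReal_norm, norm_mul, norm_inv]
    apply ENNReal.ofReal_le_ofReal
    have h5 : ‖deriv (circleMap 0 1) θ‖ = 1 := by simp [deriv_circleMap]
    rw [h5, one_mul]
    apply inv_anti₀ hw'
    have h6 := norm_sub_norm_le (circleMap 0 1 θ) w
    have h7 : ‖circleMap 0 1 θ‖ = 1 := by simp
    linarith
  have h8 := h3.trans (lintegral_mono h4)
  rw [lintegral_const_mul' _ _ ENNReal.ofReal_ne_top] at h8
  have h9 : ‖(2 * (Real.pi : ℂ) * Complex.I) • g w‖ₑ = ENNReal.ofReal (2 * Real.pi) * ‖g w‖ₑ := by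
    rw [enorm_smul, ← ofReal_norm]
    congr 2
    simp [Real.pi_pos.le]
  rw [h9] at h8
  calc ENNReal.ofReal (2 * Real.pi * (1 - ‖w‖)) * ‖g w‖ₑ
      = ENNReal.ofReal (1 - ‖w‖) * (ENNReal.ofReal (2 * Real.pi) * ‖g w‖ₑ) := by
        rw [mul_comm (2 * Real.pi), ENNReal.ofReal_mul hw'.le, mul_assoc]
    _ ≤ ENNReal.ofReal (1 - ‖w‖) * (ENNReal.ofReal (1 - ‖w‖)⁻¹ *
        ∫⁻ θ in Ioo (-Real.pi) Real.pi, ‖g (circleMap 0 1 θ)‖ₑ) := by gcongr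
    _ = _ := by
      rw [← mul_assoc, ← ENNReal.ofReal_mul hw'.le, mul_inv_cancel₀ hw'.ne', ENNReal.ofReal_one,
        one_mul]

lemma ofReal_mul_enorm_le_lintegral_ball {G : ℂ → ℂ} (hm : Measurable G) {z : ℂ} {R : ℝ}
    (hR : 0 ≤ R) (hG : DifferentiableOn ℂ G (ball z R)) :
    ENNReal.ofReal (Real.pi * R ^ 2) * ‖G z‖ₑ ≤ ∫⁻ w in ball z R, ‖G w‖ₑ := by
  have hmf : Measurable ((ball (0 : ℂ) R).indicator fun w => ‖G (z + w)‖ₑ) :=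
    (by fun_prop : Measurable fun w => ‖G (z + w)‖ₑ).indicator isOpen_ball.measurableSet
  have h1 : ∫⁻ w in ball z R, ‖G w‖ₑ = ∫⁻ w, (ball (0 : ℂ) R).indicator (fun w => ‖G (z + w)‖ₑ) w := by
    rw [← lintegral_indicator isOpen_ball.measurableSet,
      ← lintegral_add_left_eq_self _ z]
    congr 1 with w
    simp [indicator]
  have hmp : Measurable fun p : ℝ × ℝ => ENNReal.ofReal p.1 •
      (ball (0 : ℂ) R).indicator (fun w => ‖G (z + w)‖ₑ) (Complex.polarCoord.symm p) := by
    have : Measurable fun p : ℝ × ℝ => Complex.polarCoord.symm p := by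
      simp only [Complex.polarCoord_symm_apply]
      fun_prop
    exact (by fun_prop : Measurable fun p : ℝ × ℝ => ENNReal.ofReal p.1).smul (hmf.comp this)
  rw [h1, ← Complex.lintegral_comp_polarCoord_symm, polarCoord_target, Measure.volume_eq_prod,
    ← Measure.prod_restrict, lintegral_prod _ hmp.aemeasurable]
  have h2 : ∀ r ∈ Ioo 0 R, ENNReal.ofReal (2 * Real.pi * r) * ‖G z‖ₑ ≤
      ∫⁻ θ in Ioo (-Real.pi) Real.pi, ENNReal.ofReal r •
        (ball (0 : ℂ) R).indicator (fun w => ‖G (z + w)‖ₑ) (Complex.polarCoord.symm (r, θ)) := by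
    intro r hr
    have hd : DiffContOnCl ℂ (fun l : ℂ => G (z + r * l)) (ball 0 1) := by
      have : DifferentiableOn ℂ (fun l : ℂ => G (z + r * l)) (closure (ball 0 1)) := by
        refine hG.comp (by fun_prop) fun l hl => ?_
        rw [closure_ball _ one_ne_zero, mem_closedBall_zero_iff] at hl
        rw [mem_ball, dist_eq_norm, add_sub_cancel_left, norm_mul, Complex.norm_real,
          Real.norm_of_nonneg hr.1.le]
        nlinarith [hr.1, hr.2]
      exact this.diffContOnCl
    have h3 := ofReal_mul_enorm_le_lintegral_circle hd (w := 0) (by simp)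
    simp only [norm_zero, sub_zero, mul_one, mul_zero, add_zero] at h3
    simp only [smul_eq_mul]
    rw [lintegral_const_mul' _ _ ENNReal.ofReal_ne_top, mul_comm (2 * Real.pi),
      ENNReal.ofReal_mul hr.1.le, mul_assoc]
    gcongr
    refine h3.trans (lintegral_mono fun θ => ?_)
    have h4 : Complex.polarCoord.symm (r, θ) = r * circleMap 0 1 θ := by
      simp [circleMap, Complex.exp_mul_I]
    have h5 : (r * circleMap 0 1 θ : ℂ) ∈ ball (0 : ℂ) R := by
      simpa [abs_of_pos hr.1] using hr.2
    rw [h4, indicator_of_mem h5]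
  calc ENNReal.ofReal (Real.pi * R ^ 2) * ‖G z‖ₑ
      = ∫⁻ r in Ioo 0 R, ENNReal.ofReal (2 * Real.pi * r) * ‖G z‖ₑ := by
        rw [lintegral_mul_const' _ _ enorm_ne_top, ← ofReal_integral_eq_lintegral_ofReal,
          ← integral_Ioc_eq_integral_Ioo, ← intervalIntegral.integral_of_le hR]
        · congr 2
          rw [intervalIntegral.integral_const_mul, integral_id]
          ring
        · exact ((by fun_prop : Continuous fun r : ℝ => 2 * Real.pi * r).continuousOn.integrableOn_Icc
            (a := 0) (b := R)).mono_set Ioo_subset_Icc_self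
        · filter_upwards [ae_restrict_mem measurableSet_Ioo] with r hr
          exact mul_nonneg (by positivity) hr.1.le
    _ ≤ ∫⁻ r in Ioo 0 R, ∫⁻ θ in Ioo (-Real.pi) Real.pi, ENNReal.ofReal r •
        (ball (0 : ℂ) R).indicator (fun w => ‖G (z + w)‖ₑ) (Complex.polarCoord.symm (r, θ)) :=
      setLIntegral_mono' measurableSet_Ioo h2
    _ ≤ _ := lintegral_mono_set Ioo_subset_Ioi_self

lemma ofReal_rpow_mul_le_of_le_one {E : Type*} [NormedAddCommGroup E] [MeasurableSpace E]
    [ProperSpace E] {φ : E → ℝ} (hφ0 : ∀ z, 0 ≤ φ z) (hφ : ContinuousOn φ (closedBall 0 1))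
    {μ : ℝ → Measure E} (hμ : ∀ s ∈ Ioo (0 : ℝ) 1, ∀ᵐ w ∂μ s, ‖w‖ ≤ s) {m : ℕ} (hm : m ≠ 0)
    {C : ℝ≥0∞}
    (hbase : ∀ s ∈ Ioo (0 : ℝ) 1, ∀ z, ‖z‖ < s →
      ENNReal.ofReal (φ z * (s - ‖z‖) ^ m) ≤ C * ∫⁻ w, ENNReal.ofReal (φ w) ∂μ s)
    {p : ℝ} (hp : 0 < p) (hp1 : p ≤ 1) {A : ℝ≥0∞}
    (hA : ∀ s ∈ Ioo (0 : ℝ) 1, ∫⁻ w, ENNReal.ofReal (φ w ^ p) ∂μ s ≤ A) :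
    ∀ z ∈ closedBall (0 : E) 1,
      ENNReal.ofReal (φ z ^ p * (1 - ‖z‖) ^ m) ≤ C * ENNReal.ofReal (2 ^ (m / p)) * A := by
  have hcont : ContinuousOn (fun z => φ z ^ p * (1 - ‖z‖) ^ m) (closedBall 0 1) :=
    (hφ.rpow_const fun _ _ => Or.inr hp.le).mul (by fun_prop)
  obtain ⟨z₀, hz₀, hmax⟩ := (isCompact_closedBall (0 : E) 1).exists_isMaxOn
    ⟨0, by simp⟩ hcont
  intro z hz
  refine (ENNReal.ofReal_le_ofReal (hmax hz)).trans ?_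
  rw [mem_closedBall_zero_iff] at hz₀
  simp only
  rcases hz₀.eq_or_lt with h1 | h1
  · simp [h1, hm]
  rcases (hφ0 z₀).eq_or_lt with h0 | h0
  · simp [← h0, Real.zero_rpow hp.ne']
  set d := 1 - ‖z₀‖ with hd
  have hd0 : 0 < d := by linarith
  have hd1 : d ≤ 1 := by linarith [norm_nonneg z₀]
  have hs : 1 - d / 2 ∈ Ioo (0 : ℝ) 1 := ⟨by linarith, by linarith⟩
  have hle : ∀ w : E, ‖w‖ ≤ 1 - d / 2 → φ w ≤ 2 ^ (m / p) * φ z₀ := by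
    intro w hw
    have h2 : φ w ^ p * (1 - ‖w‖) ^ m ≤ φ z₀ ^ p * d ^ m :=
      hmax (show w ∈ closedBall (0 : E) 1 by rw [mem_closedBall_zero_iff]; linarith)
    have h3 : φ w ^ p * (d / 2) ^ m ≤ φ z₀ ^ p * d ^ m := by
      refine le_trans ?_ h2
      have := Real.rpow_nonneg (hφ0 w) p
      gcongr
      linarith
    have h4 : φ w ^ p ≤ (2 ^ (m / p) * φ z₀) ^ p := by
      rw [Real.mul_rpow (by positivity) h0.le, ← Real.rpow_mul (by norm_num),
        div_mul_cancel₀ _ hp.ne', Real.rpow_natCast]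
      rw [div_pow, mul_div_assoc', div_le_iff₀ (by positivity)] at h3
      have hdm : 0 < d ^ m := by positivity
      nlinarith
    exact (Real.rpow_le_rpow_iff (hφ0 w) (by positivity) hp).1 h4
  have hint : ∫⁻ w, ENNReal.ofReal (φ w) ∂μ (1 - d / 2) ≤
      ENNReal.ofReal ((2 ^ (m / p) * φ z₀) ^ (1 - p)) * A := by
    calc ∫⁻ w, ENNReal.ofReal (φ w) ∂μ (1 - d / 2)
        ≤ ∫⁻ w, ENNReal.ofReal ((2 ^ (m / p) * φ z₀) ^ (1 - p)) * ENNReal.ofReal (φ w ^ p)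
            ∂μ (1 - d / 2) := by
          apply lintegral_mono_ae
          filter_upwards [hμ _ hs] with w hw
          rw [← ENNReal.ofReal_mul (by positivity)]
          apply ENNReal.ofReal_le_ofReal
          calc φ w = φ w ^ (1 - p) * φ w ^ p := by
                rw [← Real.rpow_add_of_nonneg (hφ0 w) (by linarith) hp.le, sub_add_cancel,
                  Real.rpow_one]
            _ ≤ _ := by
                have := Real.rpow_nonneg (hφ0 w) p
                gcongr
                · exact hφ0 w
                · exact hle w hw
      _ ≤ _ := by
          rw [lintegral_const_mul' _ _ ENNReal.ofReal_ne_top]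
          gcongr
          exact hA _ hs
  have hb := (hbase _ hs z₀ (by linarith)).trans (mul_le_mul_right hint C)
  have hsd : 1 - d / 2 - ‖z₀‖ = d / 2 := by linarith
  rw [hsd] at hb
  have e1 : φ z₀ ^ p * d ^ m = (φ z₀ ^ (p - 1) * 2 ^ m) * (φ z₀ * (d / 2) ^ m) := by
    rw [Real.rpow_sub_one h0.ne', div_pow]
    field_simp
  have e2 : (2 : ℝ) ^ (m / p) = (φ z₀ ^ (p - 1) * 2 ^ m) * (2 ^ (m / p) * φ z₀) ^ (1 - p) := by
    have h5 : (2 : ℝ) ^ (m / p) = 2 ^ m * (2 ^ (m / p)) ^ (1 - p) := by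
      rw [← Real.rpow_mul (by norm_num), ← Real.rpow_natCast, ← Real.rpow_add (by norm_num)]
      congr 1
      field_simp
      ring
    have h6 : φ z₀ ^ (p - 1) * φ z₀ ^ (1 - p) = 1 := by
      rw [← Real.rpow_add h0]
      simp
    rw [Real.mul_rpow (by positivity) h0.le]
    nth_rewrite 1 [h5]
    linear_combination -(2 ^ m * (2 ^ (m / p)) ^ (1 - p)) * h6
  rw [e1, e2, ENNReal.ofReal_mul (p := φ z₀ ^ (p - 1) * 2 ^ m) (by positivity),
    ENNReal.ofReal_mul (p := φ z₀ ^ (p - 1) * 2 ^ m) (by positivity)]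
  calc _ ≤ ENNReal.ofReal (φ z₀ ^ (p - 1) * 2 ^ m) *
      (C * (ENNReal.ofReal ((2 ^ (m / p) * φ z₀) ^ (1 - p)) * A)) := by gcongr
    _ = _ := by ring

lemma ofReal_rpow_mul_le {E : Type*} [NormedAddCommGroup E] [MeasurableSpace E]
    [ProperSpace E] {φ : E → ℝ} (hφ0 : ∀ z, 0 ≤ φ z) (hφ : ContinuousOn φ (closedBall 0 1))
    {μ : ℝ → Measure E} (hμ : ∀ s ∈ Ioo (0 : ℝ) 1, ∀ᵐ w ∂μ s, ‖w‖ ≤ s) {m : ℕ} (hm : m ≠ 0)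
    {C : ℝ≥0∞}
    (hbase : ∀ k : ℕ, ∀ s ∈ Ioo (0 : ℝ) 1, ∀ z, ‖z‖ < s →
      ENNReal.ofReal (φ z ^ k * (s - ‖z‖) ^ m) ≤ C * ∫⁻ w, ENNReal.ofReal (φ w ^ k) ∂μ s)
    {p : ℝ} (hp : 0 < p) {A : ℝ≥0∞}
    (hA : ∀ s ∈ Ioo (0 : ℝ) 1, ∫⁻ w, ENNReal.ofReal (φ w ^ p) ∂μ s ≤ A) :
    ∀ z ∈ closedBall (0 : E) 1,
      ENNReal.ofReal (φ z ^ p * (1 - ‖z‖) ^ m) ≤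
        C * ENNReal.ofReal (2 ^ (m / (p / ⌈p⌉₊))) * A := by
  have hk : (0 : ℝ) < ⌈p⌉₊ := by exact_mod_cast Nat.ceil_pos.2 hp
  have hpow : ∀ w, (φ w ^ ⌈p⌉₊) ^ (p / ⌈p⌉₊) = φ w ^ p := by
    intro w
    rw [← Real.rpow_natCast, ← Real.rpow_mul (hφ0 w), mul_div_cancel₀ _ hk.ne']
  have := ofReal_rpow_mul_le_of_le_one (φ := fun w => φ w ^ ⌈p⌉₊)
    (fun z => pow_nonneg (hφ0 z) _) (hφ.pow _) hμ hm
    (hbase _) (p := p / ⌈p⌉₊) (by positivity) (div_le_one_of_le₀ (Nat.le_ceil p) hk.le) (A := A)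
    (by simpa only [hpow] using hA)
  simpa only [hpow] using this

lemma norm_sq_smul_inner_add {n : ℕ} {e : En n} (he : ‖e‖ = 1) (a b : ℂ) (ζ : En n) :
    ‖(a * inner ℂ e ζ) • e + b • (ζ - inner ℂ e ζ • e)‖ ^ 2 =
      ‖a‖ ^ 2 * ‖inner ℂ e ζ‖ ^ 2 + ‖b‖ ^ 2 * ‖ζ - inner ℂ e ζ • e‖ ^ 2 := by
  have h : inner ℂ ((a * inner ℂ e ζ) • e) (b • (ζ - inner ℂ e ζ • e)) = 0 := by
    rw [inner_smul_left, inner_smul_right, inner_sub_right, inner_smul_right,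
      inner_self_eq_norm_sq_to_K, he]
    simp
  have := norm_add_sq_eq_norm_sq_add_norm_sq_of_inner_eq_zero _ _ h
  rw [sq, this, norm_smul, norm_smul, he, norm_mul]
  ring

lemma norm_sq_eq_inner_add {n : ℕ} {e : En n} (he : ‖e‖ = 1) (ζ : En n) :
    ‖ζ‖ ^ 2 = ‖inner ℂ e ζ‖ ^ 2 + ‖ζ - inner ℂ e ζ • e‖ ^ 2 := by
  have := norm_sq_smul_inner_add he 1 1 ζ
  simpa using this

lemma measurePreserving_smul_inner_add {n : ℕ} {e : En n} (he : ‖e‖ = 1) {a b : ℂ} (ha : ‖a‖ = 1)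
    (hb : ‖b‖ = 1) :
    MeasurePreserving (fun ζ : En n => (a * inner ℂ e ζ) • e + b • (ζ - inner ℂ e ζ • e))
      (sigmaS n) (sigmaS n) := by
  let P : En n →ₗ[ℂ] En n := (innerSL ℂ e).toLinearMap.smulRight e
  let L : En n →ₗᵢ[ℂ] En n :=
    { toLinearMap := (a • P + b • (LinearMap.id - P) : En n →ₗ[ℂ] En n)
      norm_map' := fun ζ => by
        have h1 : (a • P + b • (LinearMap.id - P) : En n →ₗ[ℂ] En n) ζ =
            (a * inner ℂ e ζ) • e + b • (ζ - inner ℂ e ζ • e) := by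
          simp [P, smul_smul]
        rw [h1]
        have h2 := norm_sq_smul_inner_add he a b ζ
        rw [ha, hb, one_pow, one_mul, one_mul, ← norm_sq_eq_inner_add he] at h2
        exact (sq_eq_sq₀ (norm_nonneg _) (norm_nonneg _)).1 h2 }
  have h := measurePreserving_sigmaS (L.toLinearIsometryEquiv rfl)
  convert h using 1
  ext1 ζ
  simp [L, P, smul_smul]

lemma measurePreserving_smul_sigmaS {m : ℕ} {a : ℂ} (ha : ‖a‖ = 1) :
    MeasurePreserving (fun ζ : En (m + 1) => a • ζ) (sigmaS (m + 1)) (sigmaS (m + 1)) := by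
  have he : ‖(EuclideanSpace.single 0 1 : En (m + 1))‖ = 1 := by simp
  convert measurePreserving_smul_inner_add he ha ha using 2 with ζ
  rw [smul_sub, smul_smul]
  abel

lemma lintegral_lintegral_circle {n : ℕ} [SFinite (sigmaS n)] {T : ℝ → En n → En n}
    (hT : Measurable (Function.uncurry T))
    (hT' : ∀ θ, MeasurePreserving (T θ) (sigmaS n) (sigmaS n)) {Φ : En n → ℝ≥0∞}
    (hΦ : Measurable Φ) :
    ∫⁻ ζ, (∫⁻ θ in Ioo (-Real.pi) Real.pi, Φ (T θ ζ)) ∂(sigmaS n) =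
      ENNReal.ofReal (2 * Real.pi) * ∫⁻ ζ, Φ ζ ∂(sigmaS n) := by
  have hm : Measurable (Function.uncurry fun (ζ : En n) (θ : ℝ) => Φ (T θ ζ)) :=
    hΦ.comp (hT.comp measurable_swap)
  rw [lintegral_lintegral_swap hm.aemeasurable]
  simp_rw [(hT' _).lintegral_comp hΦ]
  rw [lintegral_const, Measure.restrict_apply_univ, Real.volume_Ioo, mul_comm]
  congr 2
  ring

lemma exists_mul_enorm_le_lintegral_sigmaS {m : ℕ} (h : sigmaS (m + 1) ≠ 0) :
    ∃ c : ℝ, 0 < c ∧ ∀ (F : En (m + 1) → ℂ) (R : ℝ), 1 < R → Measurable F →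
      DifferentiableOn ℂ F (ball 0 R) → ∀ e : En (m + 1), ‖e‖ = 1 → ∀ r ∈ Ico (0 : ℝ) 1,
        ENNReal.ofReal (c * (1 - r) ^ (m + 1)) * ‖F ((r : ℂ) • e)‖ₑ ≤
          ∫⁻ ζ, ‖F ζ‖ₑ ∂(sigmaS (m + 1)) := by
  have hprob := isProbabilityMeasure_sigmaS h
  obtain ⟨c, hc, hcap⟩ := exists_le_sigmaS_cap h
  refine ⟨c / 2 ^ (m + 1), by positivity, fun F R hR hF hd e he r hr => ?_⟩
  set δ := 1 - r with hδ
  have hδ0 : 0 < δ := by linarith [hr.2]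
  have hδ1 : δ ≤ 1 := by linarith [hr.1]
  have hΦ : Measurable fun ζ => ‖F ζ‖ₑ := hF.enorm
  have hcm : Continuous (circleMap 0 1) := continuous_circleMap 0 1
  have hcn : ∀ θ, ‖circleMap 0 1 θ‖ = 1 := fun θ => by simp
  have h2pi : ENNReal.ofReal (2 * Real.pi) ≠ 0 := by
    simp [Real.pi_pos]
  have cl : closure (ball (0 : ℂ) 1) = closedBall 0 1 := closure_ball _ one_ne_zero
  have step1 : ∫⁻ ζ, ‖F (inner ℂ e ζ • e)‖ₑ ∂(sigmaS (m + 1)) ≤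
      ∫⁻ ζ, ‖F ζ‖ₑ ∂(sigmaS (m + 1)) := by
    rw [← ENNReal.mul_le_mul_iff_right h2pi ENNReal.ofReal_ne_top,
      ← lintegral_lintegral_circle (T := fun θ ζ =>
        ((1 : ℂ) * inner ℂ e ζ) • e + circleMap 0 1 θ • (ζ - inner ℂ e ζ • e)) ?_
        (fun θ => measurePreserving_smul_inner_add he (by simp) (hcn θ)) hΦ,
      ← lintegral_const_mul' _ _ ENNReal.ofReal_ne_top]
    · apply lintegral_mono_ae
      filter_upwards [ae_sigmaS_norm] with ζ hζ
      have hg : DiffContOnCl ℂ (fun l : ℂ => F (((1 : ℂ) * inner ℂ e ζ) • e +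
          l • (ζ - inner ℂ e ζ • e))) (ball 0 1) := by
        apply DifferentiableOn.diffContOnCl
        rw [cl]
        refine hd.comp (by fun_prop) fun l hl => ?_
        rw [mem_closedBall_zero_iff] at hl
        rw [mem_ball_zero_iff]
        refine lt_of_le_of_lt ?_ hR
        rw [← abs_of_nonneg (norm_nonneg (_ : En (m + 1))), ← sq_le_one_iff_abs_le_one,
          norm_sq_smul_inner_add he]
        have h1 := norm_sq_eq_inner_add he ζ
        rw [hζ] at h1
        have h2 : ‖l‖ ^ 2 ≤ 1 := pow_le_one₀ (norm_nonneg _) hl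
        rw [norm_one]
        nlinarith [sq_nonneg ‖ζ - inner ℂ e ζ • e‖]
      have := ofReal_mul_enorm_le_lintegral_circle hg (w := 0) (by simp)
      simpa using this
    · have : Continuous (Function.uncurry fun (θ : ℝ) (ζ : En (m + 1)) =>
        ((1 : ℂ) * inner ℂ e ζ) • e + circleMap 0 1 θ • (ζ - inner ℂ e ζ • e)) := by
        unfold Function.uncurry
        fun_prop
      exact this.measurable
  refine le_trans ?_ step1
  set K := {ζ : En (m + 1) | 1 - δ / 2 < ‖inner ℂ e ζ‖} with hK
  have hKm : MeasurableSet K := (isOpen_lt continuous_const (by fun_prop)).measurableSet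
  have hΨ : Measurable fun ζ => ‖F (inner ℂ e ζ • e)‖ₑ := by
    have : Continuous fun ζ : En (m + 1) => inner ℂ e ζ • e := by fun_prop
    exact hΦ.comp this.measurable
  rw [← ENNReal.mul_le_mul_iff_right h2pi ENNReal.ofReal_ne_top,
    ← lintegral_lintegral_circle (T := fun θ ζ => circleMap 0 1 θ • ζ) ?_
      (fun θ => measurePreserving_smul_sigmaS (hcn θ)) hΨ]
  · calc ENNReal.ofReal (2 * Real.pi) *
          (ENNReal.ofReal (c / 2 ^ (m + 1) * δ ^ (m + 1)) * ‖F ((r : ℂ) • e)‖ₑ)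
        = ENNReal.ofReal (2 * Real.pi * (δ / 2)) * ‖F ((r : ℂ) • e)‖ₑ *
            ENNReal.ofReal (c * (δ / 2) ^ m) := by
          have : c / 2 ^ (m + 1) * δ ^ (m + 1) = (δ / 2) * (c * (δ / 2) ^ m) := by
            rw [div_pow]
            field_simp
            ring
          rw [this, ENNReal.ofReal_mul (p := δ / 2) (by positivity),
            ENNReal.ofReal_mul (p := 2 * Real.pi) (by positivity)]
          ring
      _ ≤ ENNReal.ofReal (2 * Real.pi * (δ / 2)) * ‖F ((r : ℂ) • e)‖ₑ * sigmaS (m + 1) K := by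
          gcongr
          exact hcap _ ⟨by linarith, by linarith⟩ e he
      _ = ∫⁻ ζ in K, ENNReal.ofReal (2 * Real.pi * (δ / 2)) * ‖F ((r : ℂ) • e)‖ₑ
            ∂(sigmaS (m + 1)) := by rw [setLIntegral_const]
      _ ≤ ∫⁻ ζ in K, (∫⁻ θ in Ioo (-Real.pi) Real.pi,
            ‖F (inner ℂ e (circleMap 0 1 θ • ζ) • e)‖ₑ) ∂(sigmaS (m + 1)) := by
          apply lintegral_mono_ae
          filter_upwards [ae_restrict_mem hKm, ae_restrict_of_ae ae_sigmaS_norm] with ζ hζK hζ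
          have hρ1 : ‖inner ℂ e ζ‖ ≤ 1 := by
            have := norm_inner_le_norm (𝕜 := ℂ) e ζ
            rwa [he, hζ, one_mul] at this
          have hρ : 1 - δ / 2 < ‖inner ℂ e ζ‖ := hζK
          have hρ0 : 0 < ‖inner ℂ e ζ‖ := by linarith
          have hne : inner ℂ e ζ ≠ 0 := norm_pos_iff.1 hρ0
          have hg : DiffContOnCl ℂ (fun l : ℂ => F ((l * inner ℂ e ζ) • e)) (ball 0 1) := by
            apply DifferentiableOn.diffContOnCl
            rw [cl]
            refine hd.comp (by fun_prop) fun l hl => ?_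
            rw [mem_closedBall_zero_iff] at hl
            rw [mem_ball_zero_iff, norm_smul, he, mul_one, norm_mul]
            exact (mul_le_one₀ hl (norm_nonneg _) hρ1).trans_lt hR
          have hw : ‖(r : ℂ) / inner ℂ e ζ‖ = r / ‖inner ℂ e ζ‖ := by
            rw [norm_div, Complex.norm_real, Real.norm_of_nonneg hr.1]
          have hw2 : δ / 2 ≤ 1 - r / ‖inner ℂ e ζ‖ := by
            rw [le_sub_comm, div_le_iff₀ hρ0]
            nlinarith
          have := ofReal_mul_enorm_le_lintegral_circle hg (w := r / inner ℂ e ζ)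
            (by rw [hw]; linarith)
          rw [hw, div_mul_cancel₀ _ hne] at this
          refine le_trans ?_ (this.trans (le_of_eq ?_))
          · gcongr
          · simp_rw [inner_smul_right]
      _ ≤ _ := setLIntegral_le_lintegral _ _
  · have : Continuous (Function.uncurry fun (θ : ℝ) (ζ : En (m + 1)) => circleMap 0 1 θ • ζ) := by
      unfold Function.uncurry
      fun_prop
    exact this.measurable

lemma ofReal_norm_rpow {E : Type*} [NormedAddCommGroup E] (x : E) {p : ℝ} (hp : 0 ≤ p) :
    ENNReal.ofReal (‖x‖ ^ p) = ‖x‖ₑ ^ p := by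
  rw [← ofReal_norm, ENNReal.ofReal_rpow_of_nonneg (norm_nonneg _) hp]

lemma exists_growth {m : ℕ} (h : sigmaS (m + 1) ≠ 0) {p : ℝ} (hp : 0 < p) :
    ∃ C : ℝ≥0∞, C ≠ ⊤ ∧ ∀ f : En (m + 1) → ℂ, Measurable f → DifferentiableOn ℂ f (Bn (m + 1)) →
      ∀ ρ ∈ Ioo (0 : ℝ) 1, ∀ A : ℝ≥0∞,
      (∀ s ∈ Ioo (0 : ℝ) 1, ∫⁻ ζ, ‖f (s • ζ)‖ₑ ^ p ∂(sigmaS (m + 1)) ≤ A) →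
      ∀ z ∈ closedBall (0 : En (m + 1)) 1,
        ENNReal.ofReal (‖f (ρ • z)‖ ^ p * (1 - ‖z‖) ^ (m + 1)) ≤ C * A := by
  obtain ⟨c, hc, hL⟩ := exists_mul_enorm_le_lintegral_sigmaS h
  refine ⟨ENNReal.ofReal c⁻¹ * ENNReal.ofReal (2 ^ (((m + 1 : ℕ) : ℝ) / (p / ⌈p⌉₊))),
    ENNReal.mul_ne_top ENNReal.ofReal_ne_top ENNReal.ofReal_ne_top, ?_⟩
  intro f hfm hfd ρ hρ A hA
  have hms : ∀ s : ℝ, Measurable fun ζ : En (m + 1) => s • ζ := fun s =>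
    (continuous_const_smul s).measurable
  have hcont : ContinuousOn (fun z => ‖f (ρ • z)‖) (closedBall (0 : En (m + 1)) 1) := by
    refine (hfd.continuousOn.comp (continuous_const_smul ρ).continuousOn fun z hz => ?_).norm
    rw [mem_closedBall_zero_iff] at hz
    rw [Bn, mem_ball_zero_iff, norm_smul, Real.norm_of_nonneg hρ.1.le]
    nlinarith [hρ.1, hρ.2]
  refine ofReal_rpow_mul_le (φ := fun z => ‖f (ρ • z)‖) (fun _ => norm_nonneg _) hcont
    (μ := fun s => (sigmaS (m + 1)).map (fun ζ => s • ζ)) ?_ (Nat.succ_ne_zero m) ?_ hp ?_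
  · intro s hs
    rw [ae_map_iff (hms s).aemeasurable (isClosed_le continuous_norm continuous_const).measurableSet]
    filter_upwards [ae_sigmaS_norm] with ζ hζ
    rw [norm_smul, hζ, Real.norm_of_nonneg hs.1.le, mul_one]
  · intro k s hs z hz
    have hρs : 0 < ρ * s := mul_pos hρ.1 hs.1
    have hρs1 : ρ * s < 1 := by nlinarith [hρ.1, hρ.2, hs.1, hs.2]
    obtain ⟨e, he, hze⟩ : ∃ e : En (m + 1), ‖e‖ = 1 ∧ z = ‖z‖ • e := by
      by_cases hz0 : z = 0
      · exact ⟨EuclideanSpace.single 0 1, by simp, by simp [hz0]⟩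
      · refine ⟨‖z‖⁻¹ • z, ?_, ?_⟩
        · rw [norm_smul, norm_inv, norm_norm, inv_mul_cancel₀ (norm_ne_zero_iff.2 hz0)]
        · rw [smul_smul, mul_inv_cancel₀ (norm_ne_zero_iff.2 hz0), one_smul]
    have hr : ‖z‖ / s ∈ Ico (0 : ℝ) 1 :=
      ⟨div_nonneg (norm_nonneg _) hs.1.le, (div_lt_one hs.1).2 hz⟩
    have hFm : Measurable fun w : En (m + 1) => f (ρ • s • w) ^ k :=
      (hfm.comp ((hms ρ).comp (hms s))).pow_const k
    have hFd : DifferentiableOn ℂ (fun w : En (m + 1) => f (ρ • s • w) ^ k) (ball 0 (ρ * s)⁻¹) := by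
      refine (hfd.comp (Differentiable.differentiableOn (by fun_prop)) fun w hw => ?_).pow k
      rw [mem_ball_zero_iff] at hw
      rw [Bn, mem_ball_zero_iff, smul_smul, norm_smul, Real.norm_of_nonneg hρs.le]
      rwa [← lt_inv_mul_iff₀ hρs, mul_one]
    have key := hL _ _ ((one_lt_inv₀ hρs).2 hρs1) hFm hFd e he _ hr
    have hz' : ρ • s • ((‖z‖ / s : ℝ) : ℂ) • e = ρ • z := by
      conv_rhs => rw [hze]
      rw [Complex.coe_smul, smul_smul s, mul_div_cancel₀ _ hs.1.ne']
    simp only [hz'] at key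
    have hm1 : Measurable fun w : En (m + 1) => ENNReal.ofReal (‖f (ρ • w)‖ ^ k) :=
      ((hfm.comp (hms ρ)).norm.pow_const k).ennreal_ofReal
    rw [lintegral_map hm1 (hms s)]
    have h1 : ∀ x : ℂ, ENNReal.ofReal (‖x‖ ^ k) = ‖x ^ k‖ₑ := fun x => by
      rw [← norm_pow, ofReal_norm]
    simp_rw [h1]
    refine le_trans ?_ (mul_le_mul_right key (ENNReal.ofReal c⁻¹))
    rw [← h1, ← mul_assoc, ← ENNReal.ofReal_mul (by positivity), inv_mul_cancel_left₀ hc.ne',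
      mul_comm (‖f (ρ • z)‖ ^ k), ENNReal.ofReal_mul (pow_nonneg (by linarith) _)]
    have h9 : s - ‖z‖ ≤ 1 - ‖z‖ / s := by
      have h10 : ‖z‖ = s * (‖z‖ / s) := (mul_div_cancel₀ _ hs.1.ne').symm
      nlinarith [hr.2, hs.2]
    gcongr ENNReal.ofReal (?_ ^ _) * _
  · intro s hs
    have hm1 : Measurable fun w : En (m + 1) => ENNReal.ofReal (‖f (ρ • w)‖ ^ p) :=
      ((hfm.comp (hms ρ)).norm.pow_const p).ennreal_ofReal
    rw [lintegral_map hm1 (hms s)]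
    simp_rw [ofReal_norm_rpow _ hp.le, smul_smul]
    exact hA _ ⟨mul_pos hρ.1 hs.1, by nlinarith [hρ.1, hρ.2, hs.1, hs.2]⟩

lemma exists_enorm_rpow_le_lintegral_ball {q : ℝ} (hq : 0 < q) :
    ∃ C : ℝ≥0∞, C ≠ ⊤ ∧ ∀ (G : ℂ → ℂ) (R : ℝ), 1 < R → Measurable G →
      DifferentiableOn ℂ G (ball 0 R) → ‖G 0‖ₑ ^ q ≤ C * ∫⁻ w in ball (0 : ℂ) 1, ‖G w‖ₑ ^ q := by
  refine ⟨ENNReal.ofReal Real.pi⁻¹ * ENNReal.ofReal (2 ^ (((2 : ℕ) : ℝ) / (q / ⌈q⌉₊))),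
    ENNReal.mul_ne_top ENNReal.ofReal_ne_top ENNReal.ofReal_ne_top, ?_⟩
  intro G R hR hGm hGd
  have hcont : ContinuousOn (fun z => ‖G z‖) (closedBall (0 : ℂ) 1) :=
    (hGd.continuousOn.mono (closedBall_subset_ball hR)).norm
  have := ofReal_rpow_mul_le (φ := fun z => ‖G z‖) (fun _ => norm_nonneg _) hcont
    (μ := fun s => volume.restrict (ball 0 s)) (C := ENNReal.ofReal Real.pi⁻¹)
    (A := ∫⁻ w in ball (0 : ℂ) 1, ‖G w‖ₑ ^ q) ?_ two_ne_zero ?_ hq ?_ 0 (by simp)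
  · simpa [ofReal_norm_rpow _ hq.le] using this
  · intro s hs
    filter_upwards [ae_restrict_mem isOpen_ball.measurableSet] with w hw
    exact (mem_ball_zero_iff.1 hw).le
  · intro k s hs z hz
    have hsub : ball z (s - ‖z‖) ⊆ ball 0 s := by
      apply ball_subset_ball'
      rw [dist_zero_right]
      linarith
    have h1 : ∀ x : ℂ, ENNReal.ofReal (‖x‖ ^ k) = ‖x ^ k‖ₑ := fun x => by
      rw [← norm_pow, ofReal_norm]
    have key := ofReal_mul_enorm_le_lintegral_ball (G := fun w => G w ^ k) (hGm.pow_const k) (z := z)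
      (R := s - ‖z‖) (by linarith)
      ((hGd.mono (hsub.trans (ball_subset_ball (hs.2.trans hR).le))).pow k)
    simp_rw [h1]
    refine le_trans ?_ (mul_le_mul_right (key.trans (lintegral_mono_set hsub))
      (ENNReal.ofReal Real.pi⁻¹))
    rw [← h1, ← mul_assoc, ← ENNReal.ofReal_mul (by positivity),
      inv_mul_cancel_left₀ Real.pi_ne_zero, mul_comm, ENNReal.ofReal_mul (by positivity)]
  · intro s hs
    simp_rw [ofReal_norm_rpow _ hq.le]
    exact lintegral_mono_set (ball_subset_ball hs.2.le)

lemma lintegral_ball_comp_add_mul {Φ : ℂ → ℝ≥0∞} (hΦ : Measurable Φ) (t : ℂ) {ρ : ℝ} (hρ : 0 < ρ) :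
    ∫⁻ w in ball (0 : ℂ) 1, Φ (t + ρ * w) = ENNReal.ofReal (ρ ^ 2)⁻¹ * ∫⁻ w in ball t ρ, Φ w := by
  have hm : Measurable fun w : ℂ => (ball t ρ).indicator Φ (t + w) :=
    (hΦ.indicator isOpen_ball.measurableSet).comp (measurable_const_add t)
  have h1 := Measure.map_addHaar_smul (volume : Measure ℂ) hρ.ne'
  have h2 : ∫⁻ w, (ball t ρ).indicator Φ (t + w) ∂(Measure.map (fun x : ℂ => ρ • x) volume) =
      ∫⁻ w : ℂ, (ball t ρ).indicator Φ (t + ρ • w) :=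
    lintegral_map hm (continuous_const_smul ρ).measurable
  rw [h1, lintegral_smul_measure, lintegral_add_left_eq_self (fun w => (ball t ρ).indicator Φ w),
    lintegral_indicator isOpen_ball.measurableSet, Complex.finrank_real_complex,
    abs_of_pos (by positivity), smul_eq_mul] at h2
  rw [h2, ← lintegral_indicator isOpen_ball.measurableSet]
  congr 1 with w
  have : w ∈ ball (0 : ℂ) 1 ↔ t + ρ • w ∈ ball t ρ := by
    rw [mem_ball_zero_iff, mem_ball, dist_eq_norm, add_sub_cancel_left, norm_smul,
      Real.norm_of_nonneg hρ.le, mul_lt_iff_lt_one_right hρ]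
  rw [Complex.real_smul] at this ⊢
  by_cases hw : w ∈ ball (0 : ℂ) 1
  · rw [indicator_of_mem hw, indicator_of_mem (this.1 hw)]
  · rw [indicator_of_notMem hw, indicator_of_notMem fun h => hw (this.2 h)]

/-- A nontangential approach region in the unit disc with vertex at `1`. -/
def diskCone : Set ℂ := {l | ‖l‖ < 1 ∧ ‖1 - l‖ ≤ 3 * (1 - ‖l‖)}

lemma measurableSet_diskCone : MeasurableSet diskCone :=
  (isOpen_lt continuous_norm continuous_const).measurableSet.inter
    (isClosed_le (f := fun l : ℂ => ‖1 - l‖) (g := fun l => 3 * (1 - ‖l‖))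
      (by fun_prop) (by fun_prop)).measurableSet

lemma rpow_le_two_rpow_abs_mul {x y e : ℝ} (hx : 0 < x) (hxy : x ≤ 2 * y) (hyx : y ≤ 2 * x) :
    x ^ e ≤ 2 ^ |e| * y ^ e := by
  have hy : 0 < y := by linarith
  rcases le_total 0 e with he | he
  · rw [abs_of_nonneg he, ← Real.mul_rpow (by norm_num) hy.le]
    exact Real.rpow_le_rpow hx.le hxy he
  · rw [abs_of_nonpos he, Real.rpow_neg (by norm_num), ← Real.inv_rpow (by norm_num),
      ← Real.mul_rpow (by norm_num) hy.le]
    exact Real.rpow_le_rpow_of_nonpos (by positivity) (by linarith) he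

lemma exists_enorm_rpow_le_lintegral_diskCone {q : ℝ} (hq : 0 < q) (b : ℝ) :
    ∃ C : ℝ≥0∞, C ≠ ⊤ ∧ ∀ H : ℂ → ℂ, Measurable H → DifferentiableOn ℂ H (ball 0 1) →
      ∀ t ∈ Ioo (0 : ℝ) 1, ‖H t‖ₑ ^ q ≤ C * ENNReal.ofReal ((1 - t) ^ (-(b * q))) *
        ∫⁻ l in diskCone, ENNReal.ofReal (‖1 - l‖ ^ (b * q - 2)) * ‖H l‖ₑ ^ q := by
  obtain ⟨C, hC, hball⟩ := exists_enorm_rpow_le_lintegral_ball hq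
  refine ⟨C * ENNReal.ofReal (4 * 2 ^ |b * q - 2|), ENNReal.mul_ne_top hC ENNReal.ofReal_ne_top, ?_⟩
  intro H hHm hHd t ht
  set d := 1 - t with hd
  have hd0 : 0 < d := by linarith [ht.2]
  have hnear : ∀ w : ℂ, ‖(t : ℂ) + w‖ ≤ t + ‖w‖ := fun w => by
    refine (norm_add_le _ _).trans ?_
    rw [Complex.norm_real, Real.norm_of_nonneg ht.1.le]
  have hGd : DifferentiableOn ℂ (fun w : ℂ => H (t + (d / 2 : ℝ) * w)) (ball 0 2) := by
    refine hHd.comp (by fun_prop) fun w hw => ?_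
    rw [mem_ball_zero_iff] at hw ⊢
    refine (hnear _).trans_lt ?_
    rw [norm_mul, Complex.norm_real, Real.norm_of_nonneg (by positivity)]
    nlinarith
  have h1 := hball _ 2 (by norm_num) (by fun_prop) hGd
  rw [mul_zero, add_zero,
    lintegral_ball_comp_add_mul (Φ := fun w => ‖H w‖ₑ ^ q) (by fun_prop) t (half_pos hd0)] at h1
  have hsub : ball (t : ℂ) (d / 2) ⊆ diskCone := by
    intro l hl
    rw [mem_ball, dist_eq_norm] at hl
    have h2 := hnear (l - t)
    rw [add_sub_cancel] at h2
    have h3 : ‖1 - l‖ ≤ d + ‖l - t‖ := by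
      have : (1 : ℂ) - l = (d : ℝ) - (l - t) := by rw [hd]; push_cast; ring
      rw [this]
      refine (norm_sub_le _ _).trans ?_
      rw [Complex.norm_real, Real.norm_of_nonneg hd0.le]
    constructor <;> linarith
  have h4 : ∀ l ∈ ball (t : ℂ) (d / 2), ENNReal.ofReal ((d / 2) ^ 2)⁻¹ * ‖H l‖ₑ ^ q ≤
      ENNReal.ofReal (4 * 2 ^ |b * q - 2|) * ENNReal.ofReal (d ^ (-(b * q))) *
        (ENNReal.ofReal (‖1 - l‖ ^ (b * q - 2)) * ‖H l‖ₑ ^ q) := by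
    intro l hl
    rw [mem_ball, dist_eq_norm] at hl
    have h3 : ‖1 - l‖ ≤ d + ‖l - t‖ := by
      have : (1 : ℂ) - l = (d : ℝ) - (l - t) := by rw [hd]; push_cast; ring
      rw [this]
      refine (norm_sub_le _ _).trans ?_
      rw [Complex.norm_real, Real.norm_of_nonneg hd0.le]
    have h5 : d ≤ ‖1 - l‖ + ‖l - t‖ := by
      have : ((d : ℝ) : ℂ) = (1 - l) + (l - t) := by rw [hd]; push_cast; ring
      have h6 := norm_add_le (1 - l) (l - t)
      rwa [← this, Complex.norm_real, Real.norm_of_nonneg hd0.le] at h6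
    rw [← mul_assoc, ← ENNReal.ofReal_mul (by positivity), ← ENNReal.ofReal_mul (by positivity)]
    gcongr
    have h7 := rpow_le_two_rpow_abs_mul (e := b * q - 2) hd0 (y := ‖1 - l‖) (by linarith)
      (by linarith)
    have h8 : ((d / 2) ^ 2)⁻¹ = 4 * d ^ (-(b * q)) * d ^ (b * q - 2) := by
      rw [mul_assoc, ← Real.rpow_add hd0, show -(b * q) + (b * q - 2) = -2 by ring,
        Real.rpow_neg hd0.le, Real.rpow_two]
      field_simp
      norm_num
    rw [h8]
    calc 4 * d ^ (-(b * q)) * d ^ (b * q - 2)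
        ≤ 4 * d ^ (-(b * q)) * (2 ^ |b * q - 2| * ‖1 - l‖ ^ (b * q - 2)) := by gcongr
      _ = _ := by ring
  refine h1.trans ?_
  rw [← lintegral_const_mul' _ _ ENNReal.ofReal_ne_top, mul_assoc, mul_assoc]
  gcongr
  rw [← mul_assoc, ← lintegral_const_mul' _ _
    (ENNReal.mul_ne_top ENNReal.ofReal_ne_top ENNReal.ofReal_ne_top)]
  exact (setLIntegral_mono' isOpen_ball.measurableSet h4).trans (lintegral_mono_set hsub)

lemma exists_lintegral_rpow_le_lintegral_diskCone {q : ℝ} (hq : 0 < q) {b : ℝ} (hb : b < 1) :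
    ∃ C : ℝ≥0∞, C ≠ ⊤ ∧ ∀ H : ℂ → ℂ, Measurable H → DifferentiableOn ℂ H (ball 0 1) →
      (∫⁻ t in Ioo (0 : ℝ) 1, ‖H t‖ₑ) ^ q ≤ C *
        ∫⁻ l in diskCone, ENNReal.ofReal (‖1 - l‖ ^ (b * q - 2)) * ‖H l‖ₑ ^ q := by
  obtain ⟨C, hC, hcone⟩ := exists_enorm_rpow_le_lintegral_diskCone hq b
  have hI : ∫⁻ t in Ioo (0 : ℝ) 1, ENNReal.ofReal ((1 - t) ^ (-b)) ≠ ⊤ := by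
    have h1 : IntervalIntegrable (fun t : ℝ => (1 - t) ^ (-b)) volume 0 1 := by
      have := (intervalIntegral.intervalIntegrable_rpow' (a := 1) (b := 0) (r := -b)
        (by linarith)).comp_sub_left 1
      simpa using this
    rw [intervalIntegrable_iff_integrableOn_Ioo_of_le zero_le_one] at h1
    exact h1.lintegral_lt_top.ne
  refine ⟨C * (∫⁻ t in Ioo (0 : ℝ) 1, ENNReal.ofReal ((1 - t) ^ (-b))) ^ q,
    ENNReal.mul_ne_top hC (ENNReal.rpow_ne_top_of_nonneg hq.le hI), fun H hHm hHd => ?_⟩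
  set X := ∫⁻ l in diskCone, ENNReal.ofReal (‖1 - l‖ ^ (b * q - 2)) * ‖H l‖ₑ ^ q with hX
  have h1 : ∀ t ∈ Ioo (0 : ℝ) 1,
      ‖H t‖ₑ ≤ ENNReal.ofReal ((1 - t) ^ (-b)) * (C * X) ^ (1 / q) := by
    intro t ht
    have h2 := hcone H hHm hHd t ht
    have h1t : 0 < 1 - t := by linarith [ht.2]
    have h3 : ENNReal.ofReal ((1 - t) ^ (-(b * q))) = ENNReal.ofReal ((1 - t) ^ (-b)) ^ q := by
      rw [ENNReal.ofReal_rpow_of_nonneg (by positivity) hq.le, ← Real.rpow_mul h1t.le, neg_mul]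
    have h4 := ENNReal.rpow_le_rpow h2 (one_div_nonneg.2 hq.le)
    rw [← ENNReal.rpow_mul, mul_one_div_cancel hq.ne', ENNReal.rpow_one, h3, mul_right_comm,
      mul_comm, ENNReal.mul_rpow_of_nonneg _ _ (one_div_nonneg.2 hq.le), ← ENNReal.rpow_mul,
      mul_one_div_cancel hq.ne', ENNReal.rpow_one] at h4
    exact h4
  calc (∫⁻ t in Ioo (0 : ℝ) 1, ‖H t‖ₑ) ^ q
      ≤ (∫⁻ t in Ioo (0 : ℝ) 1, ENNReal.ofReal ((1 - t) ^ (-b)) * (C * X) ^ (1 / q)) ^ q := by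
        gcongr ?_ ^ q
        exact setLIntegral_mono' measurableSet_Ioo h1
    _ = _ := by
        rw [lintegral_mul_const _ (by fun_prop), ENNReal.mul_rpow_of_nonneg _ _ hq.le,
          ← ENNReal.rpow_mul, one_div_mul_cancel hq.ne', ENNReal.rpow_one]
        ring

lemma exists_enorm_J_le {n : ℕ} {g : En n → ℂ} (hg : Continuous (fderiv ℂ g)) :
    ∃ C : ℝ≥0∞, C ≠ ⊤ ∧ ∀ (f : En n → ℂ), ∀ z ∈ Bn n,
      ‖J g f z‖ₑ ≤ C * ∫⁻ t in Ioo (0 : ℝ) 1, ‖f (t • z)‖ₑ := by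
  have hgc : ContinuousOn (fun w => ‖fderiv ℂ g w‖) (closedBall 0 1) := hg.norm.continuousOn
  obtain ⟨B, hB⟩ := (isCompact_closedBall (0 : En n) 1).bddAbove_image hgc
  refine ⟨ENNReal.ofReal B, ENNReal.ofReal_ne_top, fun f z hz => ?_⟩
  rw [Bn, mem_ball_zero_iff] at hz
  refine (enorm_integral_le_lintegral_enorm _).trans ?_
  rw [← lintegral_const_mul' _ _ ENNReal.ofReal_ne_top]
  refine setLIntegral_mono' measurableSet_Ioo fun t ht => ?_
  have h1 : f (t • z) * radD g (t • z) / (t : ℂ) = fderiv ℂ g (t • z) z * f (t • z) := by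
    have ht' : (t : ℂ) ≠ 0 := Complex.ofReal_ne_zero.2 ht.1.ne'
    have h2 : fderiv ℂ g (t • z) (t • z) = t * fderiv ℂ g (t • z) z := by
      conv_lhs => rw [← Complex.coe_smul t z, map_smul, smul_eq_mul]
      rw [Complex.coe_smul]
    rw [radD, h2]
    field_simp
  rw [h1, enorm_mul]
  gcongr
  rw [← ofReal_norm]
  refine ENNReal.ofReal_le_ofReal ?_
  have h3 : ‖fderiv ℂ g (t • z)‖ ≤ B := hB ⟨t • z, by
    rw [mem_closedBall_zero_iff, norm_smul, Real.norm_of_nonneg ht.1.le]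
    nlinarith [ht.1, ht.2, norm_nonneg z], rfl⟩
  refine (ContinuousLinearMap.le_opNorm _ _).trans ?_
  nlinarith [norm_nonneg (fderiv ℂ g (t • z)), norm_nonneg z]

lemma exists_lintegral_J_le {m : ℕ} [SFinite (sigmaS (m + 1))]
    {g : En (m + 1) → ℂ} (hg : Continuous (fderiv ℂ g)) {q b : ℝ} (hq : 0 < q) (hb : b < 1) :
    ∃ C : ℝ≥0∞, C ≠ ⊤ ∧ ∀ f : En (m + 1) → ℂ, Measurable f → DifferentiableOn ℂ f (Bn (m + 1)) →
      ∀ ρ ∈ Ioo (0 : ℝ) 1,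
        ∫⁻ ζ, ‖J g f (ρ • ζ)‖ₑ ^ q
          ∂(sigmaS (m + 1)) ≤
        C * ∫⁻ l in diskCone, ENNReal.ofReal (‖1 - l‖ ^ (b * q - 2)) *
          ∫⁻ ζ, ‖f (ρ • l • ζ)‖ₑ ^ q ∂(sigmaS (m + 1)) := by
  obtain ⟨C₁, hC₁, hJ⟩ := exists_enorm_J_le hg
  obtain ⟨C₂, hC₂, hcone⟩ := exists_lintegral_rpow_le_lintegral_diskCone hq hb
  have hC₁q : C₁ ^ q ≠ ⊤ := ENNReal.rpow_ne_top_of_nonneg hq.le hC₁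
  refine ⟨C₁ ^ q * C₂, ENNReal.mul_ne_top hC₁q hC₂, fun f hfm hfd ρ hρ => ?_⟩
  have hcont : Continuous fun x : En (m + 1) × ℂ => ρ • x.2 • x.1 := by fun_prop
  have hm : Measurable fun x : En (m + 1) × ℂ =>
      ENNReal.ofReal (‖1 - x.2‖ ^ (b * q - 2)) * ‖f (ρ • x.2 • x.1)‖ₑ ^ q :=
    (by fun_prop : Measurable fun x : En (m + 1) × ℂ =>
      ENNReal.ofReal (‖1 - x.2‖ ^ (b * q - 2))).mul
      ((hfm.comp hcont.measurable).enorm.pow_const q)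
  have h1 : ∀ᵐ ζ ∂(sigmaS (m + 1)),
      ‖J g f (ρ • ζ)‖ₑ ^ q ≤
        C₁ ^ q * C₂ * ∫⁻ l in diskCone,
          ENNReal.ofReal (‖1 - l‖ ^ (b * q - 2)) * ‖f (ρ • l • ζ)‖ₑ ^ q := by
    filter_upwards [ae_sigmaS_norm] with ζ hζ
    have hz : ρ • ζ ∈ Bn (m + 1) := by
      rw [Bn, mem_ball_zero_iff, norm_smul, hζ, Real.norm_of_nonneg hρ.1.le, mul_one]
      exact hρ.2
    have h2 := hcone (fun l => f (ρ • l • ζ))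
      (hfm.comp (by fun_prop : Continuous fun l : ℂ => ρ • l • ζ).measurable) (by
        refine hfd.comp (Differentiable.differentiableOn (by fun_prop)) fun l hl => ?_
        rw [mem_ball_zero_iff] at hl
        rw [Bn, mem_ball_zero_iff, norm_smul, norm_smul, hζ, Real.norm_of_nonneg hρ.1.le, mul_one]
        nlinarith [hρ.1, hρ.2])
    refine (ENNReal.rpow_le_rpow (hJ f _ hz) hq.le).trans ?_
    rw [ENNReal.mul_rpow_of_nonneg _ _ hq.le, mul_assoc]
    gcongr
    refine le_trans (le_of_eq ?_) h2
    have h3 : ∀ t : ℝ, t • ρ • ζ = ρ • (t : ℂ) • ζ := fun t => by rw [Complex.coe_smul, smul_comm]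
    simp_rw [h3]
  refine (lintegral_mono_ae h1).trans ?_
  rw [lintegral_const_mul' _ _ (ENNReal.mul_ne_top hC₁q hC₂), lintegral_lintegral_swap hm.aemeasurable]
  gcongr with l
  rw [lintegral_const_mul' _ _ ENNReal.ofReal_ne_top]

lemma exists_lintegral_rpow_smul_le {m : ℕ} (h : sigmaS (m + 1) ≠ 0) {p q : ℝ} (hp : 0 < p)
    (hpq : p ≤ q) :
    ∃ C : ℝ≥0∞, C ≠ ⊤ ∧ ∀ f : En (m + 1) → ℂ, Measurable f → DifferentiableOn ℂ f (Bn (m + 1)) →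
      ∀ ρ ∈ Ioo (0 : ℝ) 1, ∀ A : ℝ≥0∞,
      (∀ s ∈ Ioo (0 : ℝ) 1, ∫⁻ ζ, ‖f (s • ζ)‖ₑ ^ p ∂(sigmaS (m + 1)) ≤ A) →
      ∀ l : ℂ, l ≠ 0 → ‖l‖ < 1 → ∫⁻ ζ, ‖f (ρ • l • ζ)‖ₑ ^ q ∂(sigmaS (m + 1)) ≤
        (C * A) ^ ((q - p) / p) *
          ENNReal.ofReal ((1 - ‖l‖) ^ (-((m + 1 : ℕ) * ((q - p) / p)))) * A := by
  obtain ⟨C, hC, hg⟩ := exists_growth h hp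
  refine ⟨C, hC, fun f hfm hfd ρ hρ A hA l hl0 hl1 => ?_⟩
  have he : 0 ≤ (q - p) / p := div_nonneg (by linarith) hp.le
  have hd : 0 < 1 - ‖l‖ := by linarith
  have hl : 0 < ‖l‖ := norm_pos_iff.2 hl0
  set K := (C * A) ^ ((q - p) / p) *
    ENNReal.ofReal ((1 - ‖l‖) ^ (-((m + 1 : ℕ) * ((q - p) / p)))) with hK
  have h1 : ∀ᵐ ζ ∂(sigmaS (m + 1)), ‖f (ρ • l • ζ)‖ₑ ^ q ≤ K * ‖f (ρ • l • ζ)‖ₑ ^ p := by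
    filter_upwards [ae_sigmaS_norm] with ζ hζ
    have hnorm : ‖l • ζ‖ = ‖l‖ := by rw [norm_smul, hζ, mul_one]
    have h2 := hg f hfm hfd ρ hρ A hA (l • ζ) (by rw [mem_closedBall_zero_iff, hnorm]; exact hl1.le)
    rw [hnorm] at h2
    set x := ‖f (ρ • l • ζ)‖ with hx
    have hx0 : 0 ≤ x := norm_nonneg _
    have h3 : ENNReal.ofReal (x ^ (q - p)) ≤ K := by
      have h4 := ENNReal.rpow_le_rpow h2 he
      rw [ENNReal.ofReal_rpow_of_nonneg (by positivity) he] at h4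
      refine le_trans (le_of_eq ?_) (mul_le_mul_left h4 _)
      rw [← ENNReal.ofReal_mul (by positivity), Real.mul_rpow (by positivity) (by positivity),
        ← Real.rpow_mul hx0, mul_div_cancel₀ _ hp.ne', ← Real.rpow_natCast, ← Real.rpow_mul hd.le,
        mul_assoc, ← Real.rpow_add hd, add_neg_cancel, Real.rpow_zero, mul_one]
    refine le_trans (le_of_eq ?_) (mul_le_mul_left h3 _)
    rw [← ofReal_norm_rpow _ hp.le, ← ofReal_norm_rpow _ (hp.le.trans hpq),
      ← ENNReal.ofReal_mul (by positivity)]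
    rcases hx0.eq_or_lt with h0 | h0
    · rw [← hx, ← h0, Real.zero_rpow (hp.trans_le hpq).ne', Real.zero_rpow hp.ne', mul_zero]
    · rw [← Real.rpow_add h0, sub_add_cancel]
  refine (lintegral_mono_ae h1).trans ?_
  have hm : Measurable fun ζ : En (m + 1) => ‖f ((ρ * ‖l‖) • ζ)‖ₑ ^ p :=
    (hfm.comp (continuous_const_smul (ρ * ‖l‖)).measurable).enorm.pow_const p
  have hu : ‖l / ‖l‖‖ = 1 := by rw [norm_div, Complex.norm_real, norm_norm, div_self hl.ne']
  have hrot := (measurePreserving_smul_sigmaS (m := m) hu).lintegral_comp hm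
  have h5 : ∀ ζ : En (m + 1), (ρ * ‖l‖) • (l / ‖l‖) • ζ = ρ • l • ζ := fun ζ => by
    rw [mul_smul, ← Complex.coe_smul ‖l‖, smul_smul (‖l‖ : ℂ),
      mul_div_cancel₀ _ (Complex.ofReal_ne_zero.2 hl.ne')]
  simp_rw [h5] at hrot
  have hm' : Measurable fun ζ : En (m + 1) => ‖f (ρ • l • ζ)‖ₑ ^ p :=
    (hfm.comp (by fun_prop : Continuous fun ζ : En (m + 1) => ρ • l • ζ).measurable).enorm.pow_const p
  rw [lintegral_const_mul _ hm', hrot]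
  gcongr
  exact hA _ ⟨mul_pos hρ.1 hl, by nlinarith [hρ.1, hρ.2]⟩

lemma lintegral_diskCone_ne_top {c e : ℝ} (he : 0 ≤ e) (hc : e < c) :
    ∫⁻ l in diskCone, ENNReal.ofReal (‖1 - l‖ ^ (c - 2)) * ENNReal.ofReal ((1 - ‖l‖) ^ (-e)) ≠ ⊤ := by
  have h1 : IntegrableOn (fun x : ℂ => ‖x‖ ^ (c - 2 - e)) (ball 0 2) volume := by
    refine integrableOn_ball_of_norm_le_rpow (C := 1) (α := -(c - 2 - e)) (by simp) ?_ ?_ ?_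
    · rw [Complex.finrank_real_complex]
      push_cast
      linarith
    · refine ae_of_all _ fun x => ?_
      rw [neg_neg, one_mul, Real.norm_of_nonneg (by positivity)]
    · exact (by fun_prop : Measurable fun x : ℂ => ‖x‖ ^ (c - 2 - e)).aestronglyMeasurable
  have h2 : ∫⁻ x in ball (0 : ℂ) 2, ENNReal.ofReal (‖x‖ ^ (c - 2 - e)) < ⊤ := h1.lintegral_lt_top
  have h3 : ∫⁻ l : ℂ, (ball (0 : ℂ) 2).indicator
      (fun x => ENNReal.ofReal (‖x‖ ^ (c - 2 - e))) (1 - l) < ⊤ := by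
    rwa [lintegral_sub_left_eq_self, lintegral_indicator isOpen_ball.measurableSet]
  refine ne_top_of_le_ne_top (ENNReal.mul_lt_top (ENNReal.ofReal_lt_top (r := 3 ^ e)) h3).ne ?_
  rw [← lintegral_const_mul' _ _ ENNReal.ofReal_ne_top]
  refine le_trans (setLIntegral_mono' measurableSet_diskCone fun l hl => ?_)
    (setLIntegral_le_lintegral _ _)
  have hmem : 1 - l ∈ ball (0 : ℂ) 2 := by
    rw [mem_ball_zero_iff]
    have := norm_sub_le 1 l
    rw [norm_one] at this
    linarith [hl.1]
  have hpos : 0 < ‖1 - l‖ := by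
    have := norm_sub_norm_le 1 l
    rw [norm_one] at this
    linarith [hl.1]
  rw [indicator_of_mem hmem, ← ENNReal.ofReal_mul (by positivity),
    ← ENNReal.ofReal_mul (by positivity)]
  refine ENNReal.ofReal_le_ofReal ?_
  have h4 : (1 - ‖l‖) ^ (-e) ≤ (‖1 - l‖ / 3) ^ (-e) :=
    Real.rpow_le_rpow_of_nonpos (by positivity) (by linarith [hl.2]) (by linarith)
  have h5 : (‖1 - l‖ / 3) ^ (-e) = 3 ^ e * ‖1 - l‖ ^ (-e) := by
    rw [Real.div_rpow hpos.le (by norm_num), Real.rpow_neg (by norm_num : (0 : ℝ) ≤ 3), div_inv_eq_mul,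
      mul_comm]
  calc ‖1 - l‖ ^ (c - 2) * (1 - ‖l‖) ^ (-e)
      ≤ ‖1 - l‖ ^ (c - 2) * (3 ^ e * ‖1 - l‖ ^ (-e)) := by rw [← h5]; gcongr
    _ = 3 ^ e * ‖1 - l‖ ^ (c - 2 - e) := by
      rw [sub_eq_add_neg (c - 2) e, Real.rpow_add hpos]
      ring

lemma continuous_fderiv_eval {n : ℕ} (P : MvPolynomial (Fin n) ℂ) :
    Continuous (fderiv ℂ fun z : En n => MvPolynomial.eval (fun i => z i) P) := by
  have h : AnalyticOnNhd ℂ (fun z : En n => MvPolynomial.eval (fun i => z i) P) univ := by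
    intro x _
    induction P using MvPolynomial.induction_on with
    | C a => simpa using analyticAt_const
    | add P Q hP hQ => simpa only [map_add] using hP.fun_add hQ
    | mul_X P i hP =>
      simp only [map_mul, MvPolynomial.eval_X]
      exact hP.fun_mul ((EuclideanSpace.proj i : En n →L[ℂ] ℂ).analyticAt x)
  exact continuousOn_univ.1 h.fderiv.continuousOn

lemma exists_lintegral_rpow_smul_le_of_lt {m : ℕ} (h : sigmaS (m + 1) ≠ 0) {p q : ℝ} (hp : 0 < p)
    (hq : 0 < q) (hα : ((m + 1 : ℕ) : ℝ) * (1 / p - 1 / q) < 1) {A : ℝ≥0∞} (hA : A ≠ ⊤) :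
    ∃ b e : ℝ, b < 1 ∧ 0 ≤ e ∧ e < b * q ∧ ∃ D : ℝ≥0∞, D ≠ ⊤ ∧
      ∀ f : En (m + 1) → ℂ, Measurable f → DifferentiableOn ℂ f (Bn (m + 1)) →
      (∀ s ∈ Ioo (0 : ℝ) 1, ∫⁻ ζ, ‖f (s • ζ)‖ₑ ^ p ∂(sigmaS (m + 1)) ≤ A) →
      ∀ ρ ∈ Ioo (0 : ℝ) 1, ∀ l : ℂ, l ≠ 0 → ‖l‖ < 1 →
        ∫⁻ ζ, ‖f (ρ • l • ζ)‖ₑ ^ q ∂(sigmaS (m + 1)) ≤ D * ENNReal.ofReal ((1 - ‖l‖) ^ (-e)) := by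
  rcases le_total p q with hpq | hqp
  · obtain ⟨C, hC, hle⟩ := exists_lintegral_rpow_smul_le h hp hpq
    obtain ⟨b, hab, hb⟩ := exists_between hα
    have he : 0 ≤ (q - p) / p := div_nonneg (by linarith) hp.le
    refine ⟨b, (m + 1 : ℕ) * ((q - p) / p), hb, by positivity, ?_,
      (C * A) ^ ((q - p) / p) * A, ENNReal.mul_ne_top
        (ENNReal.rpow_ne_top_of_nonneg he (ENNReal.mul_ne_top hC hA)) hA, ?_⟩
    · have := mul_lt_mul_of_pos_right hab hq
      refine lt_of_eq_of_lt ?_ this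
      field_simp
    · intro f hfm hfd hfA ρ hρ l hl0 hl1
      refine (hle f hfm hfd ρ hρ A hfA l hl0 hl1).trans (le_of_eq ?_)
      ring
  · obtain ⟨C, hC, hle⟩ := exists_lintegral_rpow_smul_le h hp le_rfl
    have hprob := isProbabilityMeasure_sigmaS h
    refine ⟨1 / 2, 0, by norm_num, le_rfl, by positivity, 1 + A,
      ENNReal.add_ne_top.2 ⟨ENNReal.one_ne_top, hA⟩, ?_⟩
    intro f hfm hfd hfA ρ hρ l hl0 hl1
    have h1 := hle f hfm hfd ρ hρ A hfA l hl0 hl1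
    simp only [sub_self, zero_div, ENNReal.rpow_zero, mul_zero, neg_zero, Real.rpow_zero,
      ENNReal.ofReal_one, one_mul] at h1
    calc ∫⁻ ζ, ‖f (ρ • l • ζ)‖ₑ ^ q ∂(sigmaS (m + 1))
        ≤ ∫⁻ ζ, (1 + ‖f (ρ • l • ζ)‖ₑ ^ p) ∂(sigmaS (m + 1)) := by
          refine lintegral_mono fun ζ => ?_
          rcases le_total ‖f (ρ • l • ζ)‖ₑ 1 with h2 | h2
          · exact (ENNReal.rpow_le_one h2 hq.le).trans le_self_add
          · exact (ENNReal.rpow_le_rpow_of_exponent_le h2 hqp).trans le_add_self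
      _ = 1 + ∫⁻ ζ, ‖f (ρ • l • ζ)‖ₑ ^ p ∂(sigmaS (m + 1)) := by
          rw [lintegral_add_left measurable_const, lintegral_const, measure_univ, one_mul]
      _ ≤ (1 + A) * ENNReal.ofReal ((1 - ‖l‖) ^ (-(0 : ℝ))) := by
          rw [neg_zero, Real.rpow_zero, ENNReal.ofReal_one, mul_one]
          gcongr

lemma tendsto_hNorm_J_of_measurable {m : ℕ} (h : sigmaS (m + 1) ≠ 0) {p q : ℝ} (hp : 0 < p)
    (hq : 0 < q) (hα : ((m + 1 : ℕ) : ℝ) * (1 / p - 1 / q) < 1)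
    {g : En (m + 1) → ℂ} (hg : Continuous (fderiv ℂ g)) {f : ℕ → En (m + 1) → ℂ}
    (hfm : ∀ k, Measurable (f k)) (hfd : ∀ k, DifferentiableOn ℂ (f k) (Bn (m + 1)))
    {M : ℝ≥0∞} (hM : M ≠ ⊤) (hbd : ∀ k, hNorm (m + 1) p (f k) ≤ M)
    (hcpt : ∀ K : Set (En (m + 1)), K ⊆ Bn (m + 1) → IsCompact K →
      TendstoUniformlyOn (fun k => f k) 0 atTop K) :
    Tendsto (fun k => hNorm (m + 1) q (J g (f k))) atTop (𝓝 0) := by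
  have hprob := isProbabilityMeasure_sigmaS h
  have hA : ∀ k, ∀ s ∈ Ioo (0 : ℝ) 1, ∫⁻ ζ, ‖f k (s • ζ)‖ₑ ^ p ∂(sigmaS (m + 1)) ≤ M ^ p := by
    intro k s hs
    have h1 := hbd k
    rw [hNorm, one_div, ENNReal.rpow_inv_le_iff hp] at h1
    exact (le_iSup₂ (f := fun (r : ℝ) (_ : r ∈ Ioo (0 : ℝ) 1) =>
      ∫⁻ ζ, (‖f k (r • ζ)‖₊ : ℝ≥0∞) ^ p ∂(sigmaS (m + 1))) s hs).trans h1
  obtain ⟨b, e, hb, he, heb, D, hD, hDle⟩ := exists_lintegral_rpow_smul_le_of_lt h hp hq hα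
    (ENNReal.rpow_ne_top_of_nonneg hp.le hM)
  obtain ⟨C, hC, hJ⟩ := exists_lintegral_J_le hg hq hb
  set S : ℕ → ℝ → ℝ≥0∞ := fun k r => ⨆ z ∈ closedBall (0 : En (m + 1)) r, ‖f k z‖ₑ ^ q with hS
  have hSm : ∀ k, Measurable (S k) := fun k =>
    Monotone.measurable fun r₁ r₂ hr => biSup_mono fun z hz => closedBall_subset_closedBall hr hz
  have hS0 : ∀ r < 1, Tendsto (fun k => S k r) atTop (𝓝 0) := by
    intro r hr
    rw [ENNReal.tendsto_nhds_zero]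
    intro ε hε
    have hε' : 0 < ε ^ (1 / q) := by
      rw [pos_iff_ne_zero, Ne, ENNReal.rpow_eq_zero_iff]
      rintro (⟨h1, -⟩ | ⟨-, h1⟩)
      · exact hε.ne' h1
      · exact absurd h1 (not_lt.2 (one_div_nonneg.2 hq.le))
    have h1 := hcpt (closedBall 0 r) (closedBall_subset_ball hr) (isCompact_closedBall _ _)
    rw [EMetric.tendstoUniformlyOn_iff] at h1
    filter_upwards [h1 _ hε'] with k hk
    refine iSup₂_le fun z hz => ?_
    have h2 := (hk z hz).le
    rw [Pi.zero_apply, edist_zero_left] at h2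
    refine (ENNReal.rpow_le_rpow h2 hq.le).trans (le_of_eq ?_)
    rw [← ENNReal.rpow_mul, one_div_mul_cancel hq.ne', ENNReal.rpow_one]
  set w : ℂ → ℝ≥0∞ := fun l => ENNReal.ofReal (‖1 - l‖ ^ (b * q - 2)) with hw
  have hwm : Measurable w := by fun_prop
  set B : ℂ → ℝ≥0∞ := fun l => D * ENNReal.ofReal ((1 - ‖l‖) ^ (-e)) with hB
  have hBm : Measurable B := by fun_prop
  have hX : Tendsto (fun k => ∫⁻ l in diskCone, w l * min (B l) (S k ‖l‖)) atTop (𝓝 0) := by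
    have h1 := tendsto_lintegral_of_dominated_convergence (μ := volume.restrict diskCone)
      (F := fun k l => w l * min (B l) (S k ‖l‖)) (f := fun _ => 0) (fun l => w l * B l)
      (fun k => hwm.mul (hBm.min ((hSm k).comp measurable_norm)))
      (fun k => ae_of_all _ fun l => mul_le_mul_right (min_le_left _ _) _) ?_ ?_
    · simpa using h1
    · have h2 : ∀ l, w l * B l = D * (w l * ENNReal.ofReal ((1 - ‖l‖) ^ (-e))) := fun l => by
        rw [hB]
        ring
      simp_rw [h2]
      rw [lintegral_const_mul' _ _ hD]
      exact ENNReal.mul_ne_top hD (lintegral_diskCone_ne_top he heb)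
    · filter_upwards [ae_restrict_mem measurableSet_diskCone] with l hl
      have h2 : Tendsto (fun k => min (B l) (S k ‖l‖)) atTop (𝓝 0) :=
        tendsto_of_tendsto_of_tendsto_of_le_of_le tendsto_const_nhds (hS0 _ hl.1)
          (fun _ => zero_le) (fun _ => min_le_right _ _)
      simpa using ENNReal.Tendsto.const_mul h2 (Or.inr ENNReal.ofReal_ne_top)
  have hle : ∀ k, hNorm (m + 1) q (J g (f k)) ≤
      (C * ∫⁻ l in diskCone, w l * min (B l) (S k ‖l‖)) ^ (1 / q) := by
    intro k
    refine ENNReal.rpow_le_rpow (iSup₂_le fun ρ hρ => ?_) (one_div_nonneg.2 hq.le)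
    refine (hJ (f k) (hfm k) (hfd k) ρ hρ).trans ?_
    refine mul_le_mul_right (lintegral_mono_ae ?_) C
    have h0 : ∀ᵐ l ∂(volume.restrict diskCone), l ≠ (0 : ℂ) :=
      ae_restrict_of_ae (Measure.ae_ne volume 0)
    filter_upwards [ae_restrict_mem measurableSet_diskCone, h0] with l hl hl0
    refine mul_le_mul_right (le_min (hDle (f k) (hfm k) (hfd k) (hA k) ρ hρ l hl0 hl.1) ?_) _
    have h1 : ∀ᵐ ζ ∂(sigmaS (m + 1)), ‖f k (ρ • l • ζ)‖ₑ ^ q ≤ S k ‖l‖ := by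
      filter_upwards [ae_sigmaS_norm] with ζ hζ
      refine le_iSup₂ (f := fun (z : En (m + 1)) (_ : z ∈ closedBall (0 : En (m + 1)) ‖l‖) =>
        ‖f k z‖ₑ ^ q) (ρ • l • ζ) ?_
      rw [mem_closedBall_zero_iff, norm_smul, norm_smul, hζ, mul_one, Real.norm_of_nonneg hρ.1.le]
      exact mul_le_of_le_one_left (norm_nonneg _) hρ.2.le
    refine (lintegral_mono_ae h1).trans (le_of_eq ?_)
    rw [lintegral_const, measure_univ, mul_one]
  have hlim : Tendsto (fun k => (C * ∫⁻ l in diskCone, w l * min (B l) (S k ‖l‖)) ^ (1 / q)) atTop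
      (𝓝 0) := by
    have h1 := (ENNReal.continuous_rpow_const (y := 1 / q)).tendsto (C * 0)
    rw [mul_zero, ENNReal.zero_rpow_of_pos (one_div_pos.2 hq)] at h1
    refine h1.comp ?_
    simpa using ENNReal.Tendsto.const_mul hX (Or.inr hC)
  exact tendsto_of_tendsto_of_tendsto_of_le_of_le tendsto_const_nhds hlim (fun _ => zero_le) hle

lemma hNorm_congr {n : ℕ} {p : ℝ} {f g : En n → ℂ} (hfg : EqOn f g (Bn n)) :
    hNorm n p f = hNorm n p g := by
  refine congrArg (· ^ (1 / p)) (biSup_congr fun r hr => lintegral_congr_ae ?_)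
  filter_upwards [ae_sigmaS_norm] with ζ hζ
  rw [hfg]
  rw [Bn, mem_ball_zero_iff, norm_smul, hζ, Real.norm_of_nonneg hr.1.le, mul_one]
  exact hr.2

lemma J_congr {n : ℕ} {g f₁ f₂ : En n → ℂ} (hf : EqOn f₁ f₂ (Bn n)) :
    EqOn (J g f₁) (J g f₂) (Bn n) := by
  intro z hz
  refine setIntegral_congr_fun measurableSet_Ioo fun t ht => ?_
  have : t • z ∈ Bn n := by
    rw [Bn, mem_ball_zero_iff] at hz ⊢
    rw [norm_smul, Real.norm_of_nonneg ht.1.le]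
    nlinarith [ht.1, ht.2, norm_nonneg z]
  simp only [hf this]

lemma measurable_indicator_Bn {n : ℕ} {f : En n → ℂ} (hf : DifferentiableOn ℂ f (Bn n)) :
    Measurable ((Bn n).indicator f) := by
  classical
  rw [← piecewise_eq_indicator]
  exact hf.continuousOn.measurable_piecewise continuousOn_const isOpen_ball.measurableSet

/-- Let `0 < p, q < ∞` with `n(1/p - 1/q) < 1`. For every holomorphic
polynomial `P` on `ℂⁿ`, the operator `J_P : H^p → H^q` is compact: `‖J_P f_k‖_{H^q} → 0`
for every bounded sequence in `H^p` converging to `0` uniformly on compact subsets of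
`B_n`. -/
theorem stmt11 (n : ℕ) (hn : 1 ≤ n) (p q : ℝ) (hp : 0 < p) (hq : 0 < q)
    (hα : (n : ℝ) * (1 / p - 1 / q) < 1) (P : MvPolynomial (Fin n) ℂ)
    (f : ℕ → En n → ℂ) (hf : ∀ k, MemHp n p (f k))
    (hbd : ∃ M : ℝ≥0∞, M < ⊤ ∧ ∀ k, hNorm n p (f k) ≤ M)
    (hcpt : ∀ K : Set (En n), K ⊆ Bn n → IsCompact K →
      TendstoUniformlyOn (fun k => f k) 0 atTop K) :
    Tendsto
      (fun k => hNorm n q (J (fun z => MvPolynomial.eval (fun i => z i) P) (f k)))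
      atTop (𝓝 0) := by
  obtain ⟨m, rfl⟩ : ∃ m, n = m + 1 := ⟨n - 1, by omega⟩
  by_cases h : sigmaS (m + 1) = 0
  · have h0 : ∀ F : En (m + 1) → ℂ, hNorm (m + 1) q F = 0 := fun F => by
      simp [hNorm, h, hq]
    simp_rw [h0]
    exact tendsto_const_nhds
  · obtain ⟨M, hM, hfM⟩ := hbd
    have hEq : ∀ k, EqOn ((Bn (m + 1)).indicator (f k)) (f k) (Bn (m + 1)) := fun k =>
      eqOn_indicator
    have key := tendsto_hNorm_J_of_measurable h hp hq hα (continuous_fderiv_eval P)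
      (f := fun k => (Bn (m + 1)).indicator (f k)) (fun k => measurable_indicator_Bn (hf k).1)
      (fun k => (hf k).1.congr (hEq k)) hM.ne
      (fun k => (hNorm_congr (hEq k)).trans_le (hfM k))
      (fun K hK hKc => (hcpt K hK hKc).congr (Eventually.of_forall fun k z hz =>
        (hEq k (hK hz)).symm))
    exact key.congr fun k => hNorm_congr (J_congr (hEq k))

end
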